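/- arXiv:2411.02947 — 2 statements merged into one kernel-verified Lean document; each statement's English description precedes it below -/
import Mathlib

section
/- Let d,T ∈ ℕ and let B₁ = {x ∈ ℝ^{dT} : ‖x‖ ≤ 1}, where ‖x‖ = Σ_{t=1}^T ‖x_t‖_{ℝ^d}. Then for all probability measures μ, ν supported in B₁ one has the chain of inequalities CW₁(μ,ν) ≤ AW₁(μ,ν) ≤ 2·AV₀(μ,ν) ≤ C·TV₀(μ,ν) ≤ C·√((1/2)·D_KL(μ|ν)), where C = 2(2^T − 1). -/
open MeasureTheory ProbabilityTheory ENNReal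

noncomputable section

/-- The path space `ℝ^{dT}`: paths of length `T` with values in `ℝ^d`. -/
abbrev TPath (d T : ℕ) := Fin T → Fin d → ℝ

/-- Euclidean norm on `ℝ^d`. -/
def eNorm {d : ℕ} (v : Fin d → ℝ) : ℝ := Real.sqrt (∑ i, (v i) ^ 2)

/-- The norm `‖x‖ = ∑_{t=1}^T ‖x_t‖_{ℝ^d}` on the path space. -/
def pathNorm {d T : ℕ} (x : TPath d T) : ℝ := ∑ t, eNorm (x t)

/-- The truncated history `x_{1:t}` of a path, encoded by zeroing out coordinates after time `t`. -/
def hist {d T : ℕ} (t : ℕ) (x : TPath d T) : TPath d T :=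
  fun s => if (s : ℕ) < t then x s else 0

/-- `π` is a coupling of `μ` and `ν`. -/
def IsCoupling {d₁ d₂ T : ℕ} (μ : Measure (TPath d₁ T)) (ν : Measure (TPath d₂ T))
    (π : Measure (TPath d₁ T × TPath d₂ T)) : Prop :=
  π.map Prod.fst = μ ∧ π.map Prod.snd = ν

/-- A coupling `π` is causal: for every `t`, the conditional law of `y_{1:t}` given the full
path `x` depends only on `x_{1:t}`, expressed via conditional expectations of bounded
measurable functions of `y_{1:t}`. -/
def IsCausalCoupling {d₁ d₂ T : ℕ} (π : Measure (TPath d₁ T × TPath d₂ T)) : Prop :=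
  ∀ t : ℕ, t < T → ∀ f : TPath d₂ T → ℝ, Measurable f → (∀ y, f (hist t y) = f y) →
    (∃ C, ∀ y, |f y| ≤ C) →
    π[(fun p => f p.2) | MeasurableSpace.comap Prod.fst inferInstance]
      =ᵐ[π] π[(fun p => f p.2) | MeasurableSpace.comap (fun p => hist t p.1) inferInstance]

/-- A coupling is bicausal if both it and its coordinate swap are causal. -/
def IsBicausalCoupling {d T : ℕ} (π : Measure (TPath d T × TPath d T)) : Prop :=
  IsCausalCoupling π ∧ IsCausalCoupling (π.map Prod.swap)

/-- Causal (first order) Wasserstein distance `CW₁`. -/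
def CW1 {d T : ℕ} (μ ν : Measure (TPath d T)) : ℝ :=
  sInf { r | ∃ π : Measure (TPath d T × TPath d T), IsCoupling μ ν π ∧ IsCausalCoupling π ∧
    r = ∫ p, pathNorm (p.1 - p.2) ∂π }

/-- Adapted (first order) Wasserstein distance `AW₁`. -/
def AW1 {d T : ℕ} (μ ν : Measure (TPath d T)) : ℝ :=
  sInf { r | ∃ π : Measure (TPath d T × TPath d T), IsCoupling μ ν π ∧ IsBicausalCoupling π ∧
    r = ∫ p, pathNorm (p.1 - p.2) ∂π }

/-- Total variation `TV₀`. -/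
def TV0 {d T : ℕ} (μ ν : Measure (TPath d T)) : ℝ :=
  sInf { r | ∃ π : Measure (TPath d T × TPath d T), IsCoupling μ ν π ∧
    r = (π {p | p.1 ≠ p.2}).toReal }

/-- Adapted total variation `AV₀`. -/
def AV0 {d T : ℕ} (μ ν : Measure (TPath d T)) : ℝ :=
  sInf { r | ∃ π : Measure (TPath d T × TPath d T), IsCoupling μ ν π ∧ IsBicausalCoupling π ∧
    r = (π {p | p.1 ≠ p.2}).toReal }

open Classical in
/-- Kullback–Leibler divergence, valued in `ℝ≥0∞`. -/
def KLDiv {E : Type*} [MeasurableSpace E] (μ ν : Measure E) : ℝ≥0∞ :=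
  if μ ≪ ν ∧ Integrable (llr μ ν) μ then ENNReal.ofReal (∫ x, llr μ ν x ∂μ) else ⊤

/-- A map between path spaces is causal if its `t`-th coordinate depends only on `x_{1:t}`,
with Borel-measurability. -/
def IsCausalMap {d₁ d₂ T : ℕ} (𝒯 : TPath d₁ T → TPath d₂ T) : Prop :=
  Measurable 𝒯 ∧
    ∀ (t : Fin T) (x x' : TPath d₁ T), (∀ s : Fin T, s ≤ t → x s = x' s) → 𝒯 x t = 𝒯 x' t

/-- Standard Gaussian measure `N(0, I_{d_Z T})`. -/
def stdGaussian (dZ T : ℕ) : Measure (TPath dZ T) :=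
  Measure.pi fun _ : Fin T => Measure.pi fun _ : Fin dZ => gaussianReal 0 1

section Survival

variable {Ω : Type*}

/-- The fractions `(α, β)` of the masses `f t`, `g t` that are still coupled along the diagonal at
time `t` when each transition is coupled maximally. -/
def greedyFractions (f g : ℕ → Ω → ℝ≥0∞) : ℕ → Ω → ℝ≥0∞ × ℝ≥0∞
  | 0, _ => (1, 1)
  | t + 1, x =>
    let m := min ((greedyFractions f g t x).1 * f (t + 1) x)
      ((greedyFractions f g t x).2 * g (t + 1) x)
    (m / f (t + 1) x, m / g (t + 1) x)

/-- The first component of `greedyFractions`. -/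
def survival (f g : ℕ → Ω → ℝ≥0∞) (t : ℕ) (x : Ω) : ℝ≥0∞ := (greedyFractions f g t x).1

lemma greedyFractions_swap (f g : ℕ → Ω → ℝ≥0∞) (t : ℕ) (x : Ω) :
    greedyFractions g f t x = (greedyFractions f g t x).swap := by
  induction t with
  | zero => rfl
  | succ t ih => simp only [greedyFractions, ih, Prod.swap, min_comm]

variable {f g : ℕ → Ω → ℝ≥0∞}

lemma survival_zero (x : Ω) : survival f g 0 x = 1 := rfl

lemma survival_succ (t : ℕ) (x : Ω) : survival f g (t + 1) x =
    min (survival f g t x * f (t + 1) x) (survival g f t x * g (t + 1) x) / f (t + 1) x := by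
  simp only [survival, greedyFractions_swap f g, Prod.fst_swap, greedyFractions]

lemma survival_succ_le (t : ℕ) (x : Ω) : survival f g (t + 1) x ≤ survival f g t x := by
  rw [survival_succ]
  exact ENNReal.div_le_of_le_mul (min_le_left _ _)

lemma survival_le_one (t : ℕ) (x : Ω) : survival f g t x ≤ 1 := by
  induction t with
  | zero => exact le_rfl
  | succ t ih => exact (survival_succ_le t x).trans ih

lemma survival_succ_mul (hf : ∀ t x, f t x ≤ 1) (t : ℕ) (x : Ω) :
    survival f g (t + 1) x * f (t + 1) x =
      min (survival f g t x * f (t + 1) x) (survival g f t x * g (t + 1) x) := by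
  rw [survival_succ]
  refine ENNReal.div_mul_cancel' (fun h => ?_) fun h => ?_
  · simp [h]
  · exact absurd (h ▸ hf (t + 1) x) (by simp)

lemma sum_survival_sub (x : Ω) {t T : ℕ} (h : t ≤ T) :
    ∑ s ∈ Finset.Ico t T, (survival f g s x - survival f g (s + 1) x) + survival f g T x
      = survival f g t x := by
  induction T, h using Nat.le_induction with
  | base => simp
  | succ T h ih =>
    rw [Finset.sum_Ico_succ_top h, add_assoc, tsub_add_cancel_of_le (survival_succ_le T x), ih]

end Survival

section Projections

variable {Ω : Type*} [MeasurableSpace Ω]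

/-- `w` is measurable and depends on its argument only through the projection `H`. -/
def AdaptedTo (H : Ω → Ω) (w : Ω → ℝ≥0∞) : Prop := Measurable w ∧ ∀ x, w (H x) = w x

namespace AdaptedTo

variable {H : Ω → Ω} {v w : Ω → ℝ≥0∞}

lemma const (c : ℝ≥0∞) : AdaptedTo H fun _ => c := ⟨measurable_const, fun _ => rfl⟩

lemma mul (hv : AdaptedTo H v) (hw : AdaptedTo H w) : AdaptedTo H fun x => v x * w x :=
  ⟨hv.1.mul hw.1, fun x => by simp only [hv.2, hw.2]⟩

lemma sub (hv : AdaptedTo H v) (hw : AdaptedTo H w) : AdaptedTo H fun x => v x - w x :=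
  ⟨hv.1.sub hw.1, fun x => by simp only [hv.2, hw.2]⟩

lemma add (hv : AdaptedTo H v) (hw : AdaptedTo H w) : AdaptedTo H fun x => v x + w x :=
  ⟨hv.1.add hw.1, fun x => by simp only [hv.2, hw.2]⟩

lemma div (hv : AdaptedTo H v) (hw : AdaptedTo H w) : AdaptedTo H fun x => v x / w x :=
  ⟨hv.1.div hw.1, fun x => by simp only [hv.2, hw.2]⟩

lemma inv (hv : AdaptedTo H v) : AdaptedTo H fun x => (v x)⁻¹ :=
  ⟨hv.1.inv, fun x => by simp only [hv.2]⟩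

lemma min (hv : AdaptedTo H v) (hw : AdaptedTo H w) : AdaptedTo H fun x => Min.min (v x) (w x) :=
  ⟨hv.1.min hw.1, fun x => by simp only [hv.2, hw.2]⟩

lemma sum {ι : Type*} {s : Finset ι} {u : ι → Ω → ℝ≥0∞} (hu : ∀ i ∈ s, AdaptedTo H (u i)) :
    AdaptedTo H fun x => ∑ i ∈ s, u i x :=
  ⟨Finset.measurable_fun_sum s fun i hi => (hu i hi).1,
    fun x => Finset.sum_congr rfl fun i hi => (hu i hi).2 x⟩

lemma mono {H' : Ω → Ω} (h : ∀ x, H (H' x) = H x) (hw : AdaptedTo H w) : AdaptedTo H' w :=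
  ⟨hw.1, fun x => by rw [← hw.2 (H' x), h, hw.2]⟩

lemma indicator_lt (hv : AdaptedTo H v) (hw : AdaptedTo H w) :
    AdaptedTo H ({x | v x < w x}.indicator fun _ => 1) :=
  ⟨measurable_const.indicator (measurableSet_lt hv.1 hw.1),
    fun x => by simp only [Set.indicator, Set.mem_ofPred_eq, hv.2, hw.2]⟩

lemma ae_eq (hH : Measurable H) (hHH : ∀ x, H (H x) = H x) {ρ : Measure Ω} [IsFiniteMeasure ρ]
    {u v : Ω → ℝ≥0∞}
    (hu : AdaptedTo H u) (hv : AdaptedTo H v)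
    (h : ∀ w, AdaptedTo H w → (∀ x, w x ≤ 1) → ∫⁻ x, w x * u x ∂ρ = ∫⁻ x, w x * v x ∂ρ) :
    u =ᵐ[ρ] v := by
  have key : u =ᵐ[ρ.map H] v := by
    refine ae_eq_of_forall_setLIntegral_eq_of_sigmaFinite hu.1 hv.1 fun s hs _ => ?_
    rw [setLIntegral_map hs hu.1 hH, setLIntegral_map hs hv.1 hH,
      ← lintegral_indicator (hH hs), ← lintegral_indicator (hH hs)]
    have hw : AdaptedTo H ((H ⁻¹' s).indicator fun _ => 1) :=
      ⟨measurable_const.indicator (hH hs), fun x => by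
        by_cases hx : H x ∈ s <;> simp [hx, hHH]⟩
    have hmul : ∀ k : Ω → ℝ≥0∞, AdaptedTo H k → ∀ x,
        (H ⁻¹' s).indicator (fun x => k (H x)) x = (H ⁻¹' s).indicator (fun _ => 1) x * k x := by
      intro k hk x
      by_cases hx : H x ∈ s <;> simp [hx, hk.2]
    simp_rw [hmul u hu, hmul v hv]
    exact h _ hw fun x => Set.indicator_le_self' (fun _ _ => zero_le) x
  filter_upwards [ae_of_ae_map hH.aemeasurable key] with x hx
  rwa [hu.2, hv.2] at hx

end AdaptedTo

lemma adaptedTo_survival {f g : ℕ → Ω → ℝ≥0∞} {H : ℕ → Ω → Ω}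
    (hc : ∀ s t, s ≤ t → ∀ x, H s (H t x) = H s x)
    (hf : ∀ t, AdaptedTo (H t) (f t)) (hg : ∀ t, AdaptedTo (H t) (g t)) (t : ℕ) :
    AdaptedTo (H t) (survival f g t) := by
  have key : ∀ t, AdaptedTo (H t) (survival f g t) ∧ AdaptedTo (H t) (survival g f t) := by
    intro t
    induction t with
    | zero => exact ⟨.const 1, .const 1⟩
    | succ t ih =>
      have h1 := ih.1.mono (hc t (t + 1) t.le_succ)
      have h2 := ih.2.mono (hc t (t + 1) t.le_succ)
      refine ⟨?_, ?_⟩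
      · simpa only [← survival_succ] using ((h1.mul (hf _)).min (h2.mul (hg _))).div (hf _)
      · simpa only [← survival_succ] using ((h2.mul (hg _)).min (h1.mul (hf _))).div (hg _)
  exact (key t).1

/-- A sequence of measurable projections, `H s` retaining less information than `H t` for
`s ≤ t`. -/
structure IsProjFiltration (H : ℕ → Ω → Ω) : Prop where
  measurable : ∀ t, Measurable (H t)
  comp : ∀ s t, s ≤ t → ∀ x, H s (H t x) = H s x

lemma IsProjFiltration.idem {H : ℕ → Ω → Ω} (hH : IsProjFiltration H) (t : ℕ) (x : Ω) :
    H t (H t x) = H t x :=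
  hH.comp t t le_rfl x

lemma exists_density_le_one {μ ρ : Measure Ω} [IsFiniteMeasure ρ] (h : μ ≤ ρ) :
    ∃ F : Ω → ℝ≥0∞, Measurable F ∧ (∀ x, F x ≤ 1) ∧ ρ.withDensity F = μ := by
  have : IsFiniteMeasure μ := isFiniteMeasure_of_le ρ h
  refine ⟨fun x => min (μ.rnDeriv ρ x) 1, by fun_prop, fun x => min_le_right _ _, ?_⟩
  rw [← Measure.withDensity_rnDeriv_eq μ ρ (Measure.absolutelyContinuous_of_le h)]
  refine withDensity_congr_ae ?_
  rw [Measure.withDensity_rnDeriv_eq μ ρ (Measure.absolutelyContinuous_of_le h)]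
  filter_upwards [Measure.rnDeriv_le_one_of_le h] with x hx
  exact min_eq_left hx

variable [StandardBorelSpace Ω] [Nonempty Ω] {ρ : Measure Ω} [IsFiniteMeasure ρ] {H : Ω → Ω}

/-- A version of the conditional expectation under `ρ` of `h` given the value of `H`. -/
def cexp (ρ : Measure Ω) [IsFiniteMeasure ρ] (H : Ω → Ω) (h : Ω → ℝ≥0∞) (z : Ω) : ℝ≥0∞ :=
  ∫⁻ x, h x ∂(condDistrib (fun x => x) H ρ (H z))

lemma adaptedTo_cexp (hH : Measurable H) (hHH : ∀ x, H (H x) = H x) {h : Ω → ℝ≥0∞}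
    (hh : Measurable h) : AdaptedTo H (cexp ρ H h) :=
  ⟨(hh.lintegral_kernel (κ := condDistrib (fun x => x) H ρ)).comp hH,
    fun x => by simp only [cexp, hHH]⟩

lemma cexp_le_one {h : Ω → ℝ≥0∞} (hh : ∀ x, h x ≤ 1) (z : Ω) : cexp ρ H h z ≤ 1 :=
  (lintegral_mono hh).trans (by simp)

lemma lintegral_lintegral_condDistrib (hH : Measurable H) {F : Ω × Ω → ℝ≥0∞} (hF : Measurable F) :
    ∫⁻ z, ∫⁻ x, F (H z, x) ∂(condDistrib (fun x => x) H ρ (H z)) ∂ρ = ∫⁻ x, F (H x, x) ∂ρ := by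
  have h := congrArg (fun m : Measure (Ω × Ω) => ∫⁻ p, F p ∂m)
    (compProd_map_condDistrib (X := H) (μ := ρ) (Y := fun x : Ω => x) aemeasurable_id')
  rw [Measure.lintegral_compProd hF, lintegral_map hF (by fun_prop),
    lintegral_map hF.lintegral_kernel_prod_right' hH] at h
  simpa using h

lemma ae_condDistrib_eq (hH : Measurable H) :
    ∀ᵐ z ∂ρ, ∀ᵐ x ∂(condDistrib (fun x => x) H ρ (H z)), H x = H z := by
  have hs : MeasurableSet {p : Ω × Ω | H p.2 ≠ p.1} :=
    (measurableSet_eq_fun (hH.comp measurable_snd) measurable_fst).compl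
  have h := lintegral_lintegral_condDistrib (ρ := ρ) hH
    (F := {p : Ω × Ω | H p.2 ≠ p.1}.indicator fun _ => 1) (measurable_const.indicator hs)
  have h0 : ∀ x, {p : Ω × Ω | H p.2 ≠ p.1}.indicator (fun _ => (1 : ℝ≥0∞)) (H x, x) = 0 := by
    intro x; simp
  simp only [h0, lintegral_zero] at h
  have hm : Measurable fun z => ∫⁻ x, {p : Ω × Ω | H p.2 ≠ p.1}.indicator
      (fun _ => (1 : ℝ≥0∞)) (H z, x) ∂(condDistrib (fun x => x) H ρ (H z)) :=
    (Measurable.lintegral_kernel_prod_right' (κ := condDistrib (fun x => x) H ρ)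
      (measurable_const.indicator hs)).comp hH
  rw [lintegral_eq_zero_iff hm] at h
  filter_upwards [h] with z hz
  have hz' : condDistrib (fun x => x) H ρ (H z) {x | H x ≠ H z} = 0 := by
    have hms : MeasurableSet {x | H x ≠ H z} := (measurableSet_eq_fun hH measurable_const).compl
    rw [← lintegral_indicator_one hms]
    exact hz
  simpa [ae_iff] using hz'

lemma cexp_mul (hH : Measurable H) {w h : Ω → ℝ≥0∞}
    (hw : AdaptedTo H w) (hh : Measurable h) :
    cexp ρ H (fun x => w x * h x) =ᵐ[ρ] fun z => w z * cexp ρ H h z := by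
  filter_upwards [ae_condDistrib_eq (ρ := ρ) hH] with z hz
  rw [cexp, cexp, ← lintegral_const_mul _ hh]
  refine lintegral_congr_ae ?_
  filter_upwards [hz] with x hx
  rw [← hw.2 x, hx, hw.2]

lemma lintegral_cexp (hH : Measurable H) {h : Ω → ℝ≥0∞} (hh : Measurable h) :
    ∫⁻ z, cexp ρ H h z ∂ρ = ∫⁻ x, h x ∂ρ :=
  lintegral_lintegral_condDistrib hH (F := fun p => h p.2) (hh.comp measurable_snd)

lemma lintegral_mul_cexp (hH : Measurable H) {w h : Ω → ℝ≥0∞}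
    (hw : AdaptedTo H w) (hh : Measurable h) :
    ∫⁻ x, w x * cexp ρ H h x ∂ρ = ∫⁻ x, w x * h x ∂ρ := by
  have hwh : Measurable fun x => w x * h x := hw.1.mul hh
  rw [← lintegral_cexp hH hwh]
  exact lintegral_congr_ae (cexp_mul hH hw hh).symm

lemma cexp_of_adaptedTo (hH : Measurable H) {w : Ω → ℝ≥0∞}
    (hw : AdaptedTo H w) : cexp ρ H w =ᵐ[ρ] w := by
  have h := cexp_mul (ρ := ρ) hH hw (measurable_const (a := (1 : ℝ≥0∞)))
  simpa [cexp] using h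

/-- The relatively independent self-joining of `ρ` over `H`. -/
def relProd (ρ : Measure Ω) [IsFiniteMeasure ρ] (H : Ω → Ω) : Measure (Ω × Ω) :=
  (ρ.map H).bind (condDistrib (fun x => x) H ρ ×ₖ condDistrib (fun x => x) H ρ)

lemma lintegral_relProd (hH : Measurable H) {u v : Ω → ℝ≥0∞} (hu : Measurable u)
    (hv : Measurable v) :
    ∫⁻ p, u p.1 * v p.2 ∂(relProd ρ H) = ∫⁻ z, cexp ρ H u z * cexp ρ H v z ∂ρ := by
  have huv : Measurable fun p : Ω × Ω => u p.1 * v p.2 := by fun_prop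
  rw [relProd, Measure.lintegral_bind (Kernel.aemeasurable _) huv.aemeasurable,
    lintegral_map huv.lintegral_kernel hH]
  refine lintegral_congr fun z => ?_
  rw [Kernel.prod_apply, lintegral_prod_mul hu.aemeasurable hv.aemeasurable]
  rfl

lemma lintegral_relProd_right (hH : Measurable H) (hHH : ∀ x, H (H x) = H x) {u v : Ω → ℝ≥0∞}
    (hu : Measurable u) (hv : Measurable v) :
    ∫⁻ p, u p.1 * v p.2 ∂(relProd ρ H) = ∫⁻ x, cexp ρ H u x * v x ∂ρ := by
  rw [lintegral_relProd hH hu hv, lintegral_mul_cexp hH (adaptedTo_cexp hH hHH hu) hv]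

lemma lintegral_relProd_left (hH : Measurable H) (hHH : ∀ x, H (H x) = H x) {u v : Ω → ℝ≥0∞}
    (hu : Measurable u) (hv : Measurable v) :
    ∫⁻ p, u p.1 * v p.2 ∂(relProd ρ H) = ∫⁻ x, u x * cexp ρ H v x ∂ρ := by
  rw [lintegral_relProd hH hu hv]
  simp_rw [mul_comm (cexp ρ H u _), mul_comm (u _)]
  rw [lintegral_mul_cexp hH (adaptedTo_cexp hH hHH hv) hu]

/-- Conditional version of `survival` for the densities `F`, `G`. -/
def surv (ρ : Measure Ω) [IsFiniteMeasure ρ] (H : ℕ → Ω → Ω) (F G : Ω → ℝ≥0∞) (t : ℕ) :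
    Ω → ℝ≥0∞ :=
  survival (fun t => cexp ρ (H t) F) (fun t => cexp ρ (H t) G) t

/-- The density of the paths distributed according to `F` which decouple at step `s + 1`. -/
def excess (ρ : Measure Ω) [IsFiniteMeasure ρ] (H : ℕ → Ω → Ω) (F G : Ω → ℝ≥0∞) (s : ℕ) (x : Ω) :
    ℝ≥0∞ :=
  (surv ρ H F G s x - surv ρ H F G (s + 1) x) * F x

/-- The part of the greedy coupling carrying the pairs of paths which decouple at step `s + 1`. -/
def decouplingPart (ρ : Measure Ω) [IsFiniteMeasure ρ] (H : ℕ → Ω → Ω) (F G : Ω → ℝ≥0∞) (s : ℕ) :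
    Measure (Ω × Ω) :=
  (relProd ρ (H s)).withDensity fun p =>
    ((cexp ρ (H s) (excess ρ H F G s) p.1)⁻¹ * excess ρ H F G s p.1) * excess ρ H G F s p.2

/-- The coupling of the measures with `ρ`-densities `F` and `G` which couples each transition
maximally and lets the paths evolve independently once they differ. -/
def greedyCoupling (ρ : Measure Ω) [IsFiniteMeasure ρ] (H : ℕ → Ω → Ω) (F G : Ω → ℝ≥0∞) (T : ℕ) :
    Measure (Ω × Ω) :=
  (ρ.withDensity fun x => surv ρ H F G T x * F x).map (fun x => (x, x)) +
    ∑ s ∈ Finset.range T, decouplingPart ρ H F G s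

section Greedy

variable {H : ℕ → Ω → Ω} {F G : Ω → ℝ≥0∞}

lemma adaptedTo_surv (hH : IsProjFiltration H) (hF : Measurable F) (hG : Measurable G) (t : ℕ) :
    AdaptedTo (H t) (surv ρ H F G t) :=
  adaptedTo_survival hH.comp (fun t => adaptedTo_cexp (hH.measurable t) (hH.idem t) hF)
    (fun t => adaptedTo_cexp (hH.measurable t) (hH.idem t) hG) t

lemma measurable_excess (hH : IsProjFiltration H) (hF : Measurable F) (hG : Measurable G) (s : ℕ) :
    Measurable (excess ρ H F G s) :=
  ((adaptedTo_surv hH hF hG s).1.sub (adaptedTo_surv hH hF hG (s + 1)).1).mul hF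

lemma excess_le_one (hF1 : ∀ x, F x ≤ 1) (s : ℕ) (x : Ω) : excess ρ H F G s x ≤ 1 :=
  mul_le_one' (tsub_le_self.trans (survival_le_one _ _)) (hF1 x)

lemma surv_succ_mul_cexp (hF1 : ∀ x, F x ≤ 1) (t : ℕ) (x : Ω) :
    surv ρ H F G (t + 1) x * cexp ρ (H (t + 1)) F x =
      min (surv ρ H F G t x * cexp ρ (H (t + 1)) F x)
        (surv ρ H G F t x * cexp ρ (H (t + 1)) G x) :=
  survival_succ_mul (f := fun t => cexp ρ (H t) F) (g := fun t => cexp ρ (H t) G)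
    (fun _ => cexp_le_one hF1) t x

lemma surv_succ_mul_cexp_comm (hF1 : ∀ x, F x ≤ 1) (hG1 : ∀ x, G x ≤ 1) (t : ℕ) (x : Ω) :
    surv ρ H F G (t + 1) x * cexp ρ (H (t + 1)) F x =
      surv ρ H G F (t + 1) x * cexp ρ (H (t + 1)) G x := by
  rw [surv_succ_mul_cexp hF1, surv_succ_mul_cexp hG1, min_comm]

lemma surv_mul_cexp_comm (hF1 : ∀ x, F x ≤ 1) (hG1 : ∀ x, G x ≤ 1)
    (h0 : cexp ρ (H 0) F =ᵐ[ρ] cexp ρ (H 0) G) (t : ℕ) :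
    ∀ᵐ x ∂ρ, surv ρ H F G t x * cexp ρ (H t) F x = surv ρ H G F t x * cexp ρ (H t) G x := by
  cases t with
  | zero =>
    filter_upwards [h0] with x hx
    simp [surv, survival_zero, hx]
  | succ t => exact .of_forall (surv_succ_mul_cexp_comm hF1 hG1 t)

lemma lintegral_mul_excess_add (hH : IsProjFiltration H) (hF : Measurable F) (hG : Measurable G)
    {s : ℕ} {w : Ω → ℝ≥0∞} (hw : AdaptedTo (H s) w) :
    ∫⁻ x, w x * excess ρ H F G s x ∂ρ +
        ∫⁻ x, w x * (surv ρ H F G (s + 1) x * cexp ρ (H (s + 1)) F x) ∂ρ =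
      ∫⁻ x, w x * (surv ρ H F G s x * cexp ρ (H s) F x) ∂ρ := by
  have hS := adaptedTo_surv (ρ := ρ) hH hF hG
  have hw' := hw.mono (hH.comp s (s + 1) s.le_succ)
  simp_rw [← mul_assoc]
  rw [lintegral_mul_cexp (hH.measurable _) (hw'.mul (hS (s + 1))) hF,
    lintegral_mul_cexp (hH.measurable _) (hw.mul (hS s)) hF,
    ← lintegral_add_right (μ := ρ) (fun x => w x * excess ρ H F G s x)
      (g := fun x => w x * surv ρ H F G (s + 1) x * F x)
      ((hw'.mul (hS (s + 1))).1.mul hF)]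
  refine lintegral_congr fun x => ?_
  rw [excess, mul_assoc, ← mul_add, ← add_mul, mul_assoc]
  have hle : surv ρ H F G (s + 1) x ≤ surv ρ H F G s x := survival_succ_le s x
  rw [tsub_add_cancel_of_le hle]

lemma cexp_excess_comm (hH : IsProjFiltration H) (hF : Measurable F) (hG : Measurable G)
    (hF1 : ∀ x, F x ≤ 1) (hG1 : ∀ x, G x ≤ 1)
    (h0 : cexp ρ (H 0) F =ᵐ[ρ] cexp ρ (H 0) G) (s : ℕ) :
    cexp ρ (H s) (excess ρ H F G s) =ᵐ[ρ] cexp ρ (H s) (excess ρ H G F s) := by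
  have hm1 := measurable_excess (ρ := ρ) hH hF hG s
  have hm2 := measurable_excess (ρ := ρ) hH hG hF s
  refine AdaptedTo.ae_eq (hH.measurable s) (hH.idem s)
    (adaptedTo_cexp (hH.measurable s) (hH.idem s) hm1)
    (adaptedTo_cexp (hH.measurable s) (hH.idem s) hm2) fun w hw hw1 => ?_
  rw [lintegral_mul_cexp (hH.measurable s) hw hm1,
    lintegral_mul_cexp (hH.measurable s) hw hm2]
  have e1 := lintegral_mul_excess_add (ρ := ρ) hH hF hG hw
  have e2 := lintegral_mul_excess_add (ρ := ρ) hH hG hF hw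
  have e3 : ∫⁻ x, w x * (surv ρ H F G s x * cexp ρ (H s) F x) ∂ρ =
      ∫⁻ x, w x * (surv ρ H G F s x * cexp ρ (H s) G x) ∂ρ := by
    refine lintegral_congr_ae ?_
    filter_upwards [surv_mul_cexp_comm hF1 hG1 h0 s] with x hx
    rw [hx]
  simp_rw [surv_succ_mul_cexp_comm hF1 hG1 s] at e1
  rw [e3, ← e2] at e1
  refine (ENNReal.add_left_inj ?_).1 e1
  have : ∫⁻ x, w x * (surv ρ H G F (s + 1) x * cexp ρ (H (s + 1)) G x) ∂ρ ≤ ∫⁻ _, 1 ∂ρ :=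
    lintegral_mono fun x => mul_le_one' (hw1 x)
      (mul_le_one' (survival_le_one _ _) (cexp_le_one hG1 _))
  exact ne_top_of_le_ne_top (by simp) this

lemma lintegral_decouplingPart (hH : IsProjFiltration H) (hF : Measurable F) (hG : Measurable G)
    {s : ℕ} {h φ : Ω → ℝ≥0∞} (hh : Measurable h) (hφ : Measurable φ) :
    ∫⁻ p, h p.1 * φ p.2 ∂(decouplingPart ρ H F G s) =
      ∫⁻ x, h x * ((cexp ρ (H s) (excess ρ H F G s) x)⁻¹ * excess ρ H F G s x *
        cexp ρ (H s) (fun y => excess ρ H G F s y * φ y) x) ∂ρ := by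
  have hm1 := measurable_excess (ρ := ρ) hH hF hG s
  have hm2 := measurable_excess (ρ := ρ) hH hG hF s
  have hc := (adaptedTo_cexp (ρ := ρ) (hH.measurable s) (hH.idem s) hm1).1
  rw [decouplingPart, lintegral_withDensity_eq_lintegral_mul _ (by fun_prop) (by fun_prop)]
  rw [← lintegral_congr (f := fun p : Ω × Ω =>
      (h p.1 * ((cexp ρ (H s) (excess ρ H F G s) p.1)⁻¹ * excess ρ H F G s p.1)) *
        (excess ρ H G F s p.2 * φ p.2)) (fun p => by simp only [Pi.mul_apply]; ring),
    lintegral_relProd_left (hH.measurable s) (hH.idem s)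
      (u := fun x => h x * ((cexp ρ (H s) (excess ρ H F G s) x)⁻¹ * excess ρ H F G s x))
      (v := fun y => excess ρ H G F s y * φ y) (by fun_prop) (by fun_prop)]
  exact lintegral_congr fun x => by ring

lemma lintegral_decouplingPart_swap (hH : IsProjFiltration H) (hF : Measurable F)
    (hG : Measurable G) (hF1 : ∀ x, F x ≤ 1) (hG1 : ∀ x, G x ≤ 1)
    (h0 : cexp ρ (H 0) F =ᵐ[ρ] cexp ρ (H 0) G)
    {s : ℕ} {h φ : Ω → ℝ≥0∞} (hh : Measurable h) (hφ : Measurable φ) :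
    ∫⁻ p, φ p.1 * h p.2 ∂(decouplingPart ρ H F G s) =
      ∫⁻ p, h p.1 * φ p.2 ∂(decouplingPart ρ H G F s) := by
  have hm1 := measurable_excess (ρ := ρ) hH hF hG s
  have hm2 := measurable_excess (ρ := ρ) hH hG hF s
  have hc := adaptedTo_cexp (ρ := ρ) (hH.measurable s) (hH.idem s) hm1
  have hc1 := hc.1
  rw [lintegral_decouplingPart hH hG hF hh hφ, decouplingPart,
    lintegral_withDensity_eq_lintegral_mul _ (by fun_prop) (by fun_prop)]
  rw [← lintegral_congr (f := fun p : Ω × Ω =>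
      ((cexp ρ (H s) (excess ρ H F G s) p.1)⁻¹ * (excess ρ H F G s p.1 * φ p.1)) *
        (excess ρ H G F s p.2 * h p.2)) (fun p => by simp only [Pi.mul_apply]; ring),
    lintegral_relProd_right (hH.measurable s) (hH.idem s)
      (u := fun x => (cexp ρ (H s) (excess ρ H F G s) x)⁻¹ * (excess ρ H F G s x * φ x))
      (v := fun y => excess ρ H G F s y * h y) (by fun_prop) (by fun_prop)]
  refine lintegral_congr_ae ?_
  filter_upwards [cexp_mul (ρ := ρ) (hH.measurable s) hc.inv (hm1.mul hφ),
    cexp_excess_comm hH hF hG hF1 hG1 h0 s] with x hx hx'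
  simp only [Pi.mul_apply, Pi.mul_def] at hx
  rw [hx, hx']
  ring

lemma inv_cexp_mul_cexp_mul {K : Ω → Ω} (hK : Measurable K) (hKK : ∀ x, K (K x) = K x)
    {a : Ω → ℝ≥0∞} (ha : Measurable a) (ha1 : ∀ x, a x ≤ 1) :
    ∀ᵐ x ∂ρ, (cexp ρ K a x)⁻¹ * cexp ρ K a x * a x = a x := by
  have hc := adaptedTo_cexp (ρ := ρ) hK hKK ha
  have hw : AdaptedTo K ({x | cexp ρ K a x = 0}.indicator fun _ => 1) :=
    ⟨measurable_const.indicator (hc.1 (measurableSet_singleton 0)),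
      fun x => by simp only [Set.indicator, Set.mem_ofPred_eq, hc.2]⟩
  have h := lintegral_mul_cexp (ρ := ρ) hK hw ha
  have h0 : ∀ x, {x | cexp ρ K a x = 0}.indicator (fun _ => (1 : ℝ≥0∞)) x * cexp ρ K a x = 0 := by
    intro x
    by_cases hx : cexp ρ K a x = 0 <;> simp [hx]
  simp only [h0, lintegral_zero] at h
  have hm : Measurable fun x => {x | cexp ρ K a x = 0}.indicator (fun _ => (1 : ℝ≥0∞)) x * a x :=
    hw.1.mul ha
  filter_upwards [(lintegral_eq_zero_iff hm).1 h.symm] with x hx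
  by_cases hcx : cexp ρ K a x = 0
  · have : a x = 0 := by simpa [hcx] using hx
    simp [this]
  · rw [ENNReal.inv_mul_cancel hcx (ne_top_of_le_ne_top one_ne_top (cexp_le_one ha1 x)), one_mul]

lemma lintegral_decouplingPart_of_adaptedTo (hH : IsProjFiltration H) (hF : Measurable F)
    (hG : Measurable G) (hF1 : ∀ x, F x ≤ 1) (hG1 : ∀ x, G x ≤ 1)
    (h0 : cexp ρ (H 0) F =ᵐ[ρ] cexp ρ (H 0) G)
    {s : ℕ} {h φ : Ω → ℝ≥0∞} (hh : Measurable h) (hφ : AdaptedTo (H s) φ) :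
    ∫⁻ p, h p.1 * φ p.2 ∂(decouplingPart ρ H F G s) =
      ∫⁻ x, h x * (φ x * excess ρ H F G s x) ∂ρ := by
  have hm1 := measurable_excess (ρ := ρ) hH hF hG s
  have hm2 := measurable_excess (ρ := ρ) hH hG hF s
  rw [lintegral_decouplingPart hH hF hG hh hφ.1]
  refine lintegral_congr_ae ?_
  filter_upwards [cexp_mul (ρ := ρ) (hH.measurable s) hφ hm2,
    cexp_excess_comm hH hF hG hF1 hG1 h0 s,
    inv_cexp_mul_cexp_mul (ρ := ρ) (hH.measurable s) (hH.idem s) hm1 (excess_le_one hF1 s)]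
    with x hx hx' hx''
  simp_rw [mul_comm (φ _)] at hx
  rw [hx, ← hx', mul_comm (φ x)]
  conv_rhs => rw [← hx'']
  ring

/-- The conditional expectation of `φ` under the second marginal given the first one, for the
greedy coupling and a `φ` depending only on the history up to time `t`. -/
def greedyCond (ρ : Measure Ω) [IsFiniteMeasure ρ] (H : ℕ → Ω → Ω) (F G : Ω → ℝ≥0∞) (t : ℕ)
    (φ : Ω → ℝ≥0∞) (x : Ω) : ℝ≥0∞ :=
  φ x * surv ρ H F G t x + ∑ s ∈ Finset.range t, (cexp ρ (H s) (excess ρ H F G s) x)⁻¹ *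
    (surv ρ H F G s x - surv ρ H F G (s + 1) x) *
      cexp ρ (H s) (fun y => excess ρ H G F s y * φ y) x

lemma adaptedTo_greedyCond (hH : IsProjFiltration H) (hF : Measurable F) (hG : Measurable G)
    {t : ℕ} {φ : Ω → ℝ≥0∞} (hφ : AdaptedTo (H t) φ) :
    AdaptedTo (H t) (greedyCond ρ H F G t φ) := by
  have hS := adaptedTo_surv (ρ := ρ) hH hF hG
  refine (hφ.mul (hS t)).add (.sum fun s hs => ?_)
  have hst := Finset.mem_range.1 hs
  have h1 := adaptedTo_cexp (ρ := ρ) (hH.measurable s) (hH.idem s)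
    (measurable_excess (ρ := ρ) hH hF hG s)
  have h2 := adaptedTo_cexp (ρ := ρ) (hH.measurable s) (hH.idem s)
    ((measurable_excess (ρ := ρ) hH hG hF s).mul hφ.1)
  exact ((h1.mono (hH.comp s t hst.le)).inv.mul
    (((hS s).mono (hH.comp s t hst.le)).sub ((hS (s + 1)).mono (hH.comp _ t hst)))).mul
      (h2.mono (hH.comp s t hst.le))

lemma lintegral_greedyCoupling (hH : IsProjFiltration H) (hF : Measurable F)
    (hG : Measurable G) (hF1 : ∀ x, F x ≤ 1) (hG1 : ∀ x, G x ≤ 1)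
    (h0 : cexp ρ (H 0) F =ᵐ[ρ] cexp ρ (H 0) G) {t T : ℕ} (htT : t ≤ T)
    {h φ : Ω → ℝ≥0∞} (hh : Measurable h) (hφ : AdaptedTo (H t) φ) :
    ∫⁻ p, h p.1 * φ p.2 ∂(greedyCoupling ρ H F G T) =
      ∫⁻ x, h x * greedyCond ρ H F G t φ x * F x ∂ρ := by
  have hS := fun t => (adaptedTo_surv (ρ := ρ) hH hF hG t).1
  have hφ1 := hφ.1
  have hc := fun s => (adaptedTo_cexp (ρ := ρ) (hH.measurable s) (hH.idem s)
    (measurable_excess (ρ := ρ) hH hF hG s)).1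
  have hc' := fun s => (adaptedTo_cexp (ρ := ρ) (hH.measurable s) (hH.idem s)
    ((measurable_excess (ρ := ρ) hH hG hF s).mul hφ1)).1
  simp only [Pi.mul_def] at hc'
  rw [greedyCoupling, lintegral_add_measure, lintegral_map (by fun_prop) (by fun_prop),
    lintegral_withDensity_eq_lintegral_mul _ (by fun_prop) (by fun_prop),
    lintegral_finsetSum_measure, ← Finset.sum_range_add_sum_Ico _ htT]
  have e1 : ∀ s ∈ Finset.range t, ∫⁻ p, h p.1 * φ p.2 ∂(decouplingPart ρ H F G s) =
      ∫⁻ x, h x * ((cexp ρ (H s) (excess ρ H F G s) x)⁻¹ *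
        (surv ρ H F G s x - surv ρ H F G (s + 1) x) *
          cexp ρ (H s) (fun y => excess ρ H G F s y * φ y) x) * F x ∂ρ := by
    intro s _
    rw [lintegral_decouplingPart hH hF hG hh hφ1]
    exact lintegral_congr fun x => by rw [excess]; ring
  have e2 : ∀ s ∈ Finset.Ico t T, ∫⁻ p, h p.1 * φ p.2 ∂(decouplingPart ρ H F G s) =
      ∫⁻ x, h x * (φ x * (surv ρ H F G s x - surv ρ H F G (s + 1) x)) * F x ∂ρ := by
    intro s hs
    rw [lintegral_decouplingPart_of_adaptedTo hH hF hG hF1 hG1 h0 hh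
      (hφ.mono (hH.comp t s (Finset.mem_Ico.1 hs).1))]
    exact lintegral_congr fun x => by rw [excess]; ring
  rw [Finset.sum_congr rfl e1, Finset.sum_congr rfl e2,
    ← lintegral_finsetSum _ (fun s _ => by fun_prop),
    ← lintegral_finsetSum _ (fun s _ => by fun_prop), ← lintegral_add_left (by fun_prop),
    ← lintegral_add_left (by fun_prop)]
  refine lintegral_congr fun x => ?_
  have hsum : ∑ s ∈ Finset.Ico t T, (surv ρ H F G s x - surv ρ H F G (s + 1) x) +
      surv ρ H F G T x = surv ρ H F G t x := sum_survival_sub x htT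
  rw [greedyCond, ← hsum]
  simp only [Pi.mul_apply, ← Finset.sum_mul, ← Finset.mul_sum]
  ring

lemma lintegral_greedyCoupling_swap (hH : IsProjFiltration H) (hF : Measurable F)
    (hG : Measurable G) (hF1 : ∀ x, F x ≤ 1) (hG1 : ∀ x, G x ≤ 1)
    (h0 : cexp ρ (H 0) F =ᵐ[ρ] cexp ρ (H 0) G) {T : ℕ} (hT : ∀ x, H T x = x)
    {h φ : Ω → ℝ≥0∞} (hh : Measurable h) (hφ : Measurable φ) :
    ∫⁻ p, φ p.1 * h p.2 ∂(greedyCoupling ρ H F G T) =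
      ∫⁻ p, h p.1 * φ p.2 ∂(greedyCoupling ρ H G F T) := by
  have hS := fun t => (adaptedTo_surv (ρ := ρ) hH hF hG t).1
  have hS' := fun t => (adaptedTo_surv (ρ := ρ) hH hG hF t).1
  have hadapt : ∀ {u : Ω → ℝ≥0∞}, Measurable u → AdaptedTo (H T) u :=
    fun hu => ⟨hu, fun x => by rw [hT]⟩
  rw [greedyCoupling, greedyCoupling, lintegral_add_measure, lintegral_add_measure,
    lintegral_map (by fun_prop) (by fun_prop), lintegral_map (by fun_prop) (by fun_prop),
    lintegral_withDensity_eq_lintegral_mul _ (by fun_prop) (by fun_prop),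
    lintegral_withDensity_eq_lintegral_mul _ (by fun_prop) (by fun_prop),
    lintegral_finsetSum_measure, lintegral_finsetSum_measure,
    Finset.sum_congr rfl fun s _ => lintegral_decouplingPart_swap hH hF hG hF1 hG1 h0 hh hφ]
  congr 1
  refine lintegral_congr_ae ?_
  filter_upwards [surv_mul_cexp_comm hF1 hG1 h0 T,
    cexp_of_adaptedTo (ρ := ρ) (hH.measurable T) (hadapt hF),
    cexp_of_adaptedTo (ρ := ρ) (hH.measurable T) (hadapt hG)] with x h1 h2 h3
  rw [h2, h3] at h1
  simp only [Pi.mul_apply, h1, mul_comm (φ x)]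

lemma lintegral_cexp_sub_le (hH : IsProjFiltration H) (hF : Measurable F) (hG : Measurable G)
    (hG1 : ∀ x, G x ≤ 1) {δ : ℝ≥0∞}
    (hδ : ∀ A, MeasurableSet A → ∫⁻ x in A, F x ∂ρ ≤ ∫⁻ x in A, G x ∂ρ + δ) (t : ℕ) :
    ∫⁻ x, (cexp ρ (H t) F x - cexp ρ (H t) G x) ∂ρ ≤ δ := by
  have hf := adaptedTo_cexp (ρ := ρ) (hH.measurable t) (hH.idem t) hF
  have hg := adaptedTo_cexp (ρ := ρ) (hH.measurable t) (hH.idem t) hG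
  have hw := hg.indicator_lt hf
  have hA : MeasurableSet {x | cexp ρ (H t) G x < cexp ρ (H t) F x} := measurableSet_lt hg.1 hf.1
  set A := {x | cexp ρ (H t) G x < cexp ρ (H t) F x} with hAdef
  have hint : ∀ {K : Ω → ℝ≥0∞}, Measurable K →
      ∫⁻ x, A.indicator (fun _ => 1) x * cexp ρ (H t) K x ∂ρ = ∫⁻ x in A, K x ∂ρ := by
    intro K hK
    rw [lintegral_mul_cexp (hH.measurable t) hw hK, ← lintegral_indicator hA]
    refine lintegral_congr fun x => ?_
    by_cases hx : x ∈ A <;> simp [hx]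
  have hsub : ∀ x, cexp ρ (H t) F x - cexp ρ (H t) G x =
      A.indicator (fun _ => 1) x * cexp ρ (H t) F x -
        A.indicator (fun _ => 1) x * cexp ρ (H t) G x := by
    intro x
    by_cases hx : x ∈ A
    · simp [hx]
    · have hx' : ¬ cexp ρ (H t) G x < cexp ρ (H t) F x := hx
      simpa [hx] using tsub_eq_zero_of_le (le_of_not_gt hx')
  have hfin : ∫⁻ x, A.indicator (fun _ => 1) x * cexp ρ (H t) G x ∂ρ ≠ ∞ := by
    rw [hint hG]
    refine ne_top_of_le_ne_top (b := ρ A) (by simp) ?_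
    exact (lintegral_mono hG1).trans (by simp)
  have hm : Measurable fun x => A.indicator (fun _ => 1) x * cexp ρ (H t) G x := hw.1.mul hg.1
  simp_rw [hsub]
  rw [lintegral_sub hm hfin (.of_forall fun x => ?_), hint hF, hint hG,
    tsub_le_iff_left]
  · exact hδ A hA
  · by_cases hx : x ∈ A
    · simpa [hx] using (show cexp ρ (H t) G x < cexp ρ (H t) F x from hx).le
    · simp [hx]

lemma lintegral_excess_le (hH : IsProjFiltration H) (hF : Measurable F) (hG : Measurable G)
    (hF1 : ∀ x, F x ≤ 1) (s : ℕ) :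
    ∫⁻ x, excess ρ H F G s x ∂ρ ≤
      ∫⁻ x, (cexp ρ (H (s + 1)) F x - cexp ρ (H (s + 1)) G x) ∂ρ +
        ∫⁻ x, (surv ρ H F G s x - surv ρ H G F s x) * cexp ρ (H s) G x ∂ρ := by
  have hS := adaptedTo_surv (ρ := ρ) hH hF hG
  have hS' := adaptedTo_surv (ρ := ρ) hH hG hF
  have hmono : ∀ {w : Ω → ℝ≥0∞}, AdaptedTo (H s) w → AdaptedTo (H (s + 1)) w :=
    fun hw => hw.mono (hH.comp s (s + 1) s.le_succ)
  have hf := adaptedTo_cexp (ρ := ρ) (hH.measurable (s + 1)) (hH.idem (s + 1)) hF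
  have hg := adaptedTo_cexp (ρ := ρ) (hH.measurable (s + 1)) (hH.idem (s + 1)) hG
  simp only [excess]
  rw [← lintegral_mul_cexp (hH.measurable (s + 1))
      ((hmono (hS s)).sub (hS (s + 1))) hF,
    lintegral_mul_cexp (hH.measurable s) ((hS s).sub (hS' s)) hG,
    ← lintegral_mul_cexp (hH.measurable (s + 1))
      (hmono ((hS s).sub (hS' s))) hG,
    ← lintegral_add_left (hf.sub hg).1]
  refine lintegral_mono fun x => ?_
  simp only
  set f := cexp ρ (H (s + 1)) F x
  set g := cexp ρ (H (s + 1)) G x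
  set a := surv ρ H F G s x
  set b := surv ρ H G F s x
  have hf1 : f ≠ ∞ := ne_top_of_le_ne_top one_ne_top (cexp_le_one hF1 x)
  have ha1 : a ≤ 1 := survival_le_one s x
  rw [ENNReal.sub_mul fun _ _ => hf1, surv_succ_mul_cexp hF1, tsub_le_iff_right]
  change a * f ≤ f - g + (a - b) * g + min (a * f) (b * g)
  rcases le_total (a * f) (b * g) with h | h
  · rw [min_eq_left h]
    exact le_add_self
  · rw [min_eq_right h]
    calc a * f ≤ a * (f - g + g) := by gcongr; exact le_tsub_add
      _ = a * (f - g) + a * g := mul_add _ _ _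
      _ ≤ 1 * (f - g) + (a - b + b) * g := by gcongr; exact le_tsub_add
      _ = f - g + (a - b) * g + b * g := by rw [one_mul, add_mul, add_assoc]

lemma lintegral_surv_sub_mul_le (hF1 : ∀ x, F x ≤ 1) (hG1 : ∀ x, G x ≤ 1)
    (h0 : cexp ρ (H 0) F =ᵐ[ρ] cexp ρ (H 0) G) (s : ℕ) :
    ∫⁻ x, (surv ρ H F G s x - surv ρ H G F s x) * cexp ρ (H s) G x ∂ρ ≤
      ∫⁻ x, (cexp ρ (H s) G x - cexp ρ (H s) F x) ∂ρ := by
  refine lintegral_mono_ae ?_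
  filter_upwards [surv_mul_cexp_comm hF1 hG1 h0 s] with x hx
  have hf1 : cexp ρ (H s) F x ≠ ∞ := ne_top_of_le_ne_top one_ne_top (cexp_le_one hF1 x)
  have hg1 : cexp ρ (H s) G x ≠ ∞ := ne_top_of_le_ne_top one_ne_top (cexp_le_one hG1 x)
  have ha1 : surv ρ H F G s x ≤ 1 := survival_le_one s x
  rw [ENNReal.sub_mul fun _ _ => hg1, ← hx,
    ← ENNReal.mul_sub fun _ _ => ne_top_of_le_ne_top one_ne_top ha1]
  exact mul_le_of_le_one_left' ha1

lemma greedyCoupling_ne_le (hH : IsProjFiltration H) (hF : Measurable F)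
    (hG : Measurable G) (hF1 : ∀ x, F x ≤ 1) (hG1 : ∀ x, G x ≤ 1)
    (h0 : cexp ρ (H 0) F =ᵐ[ρ] cexp ρ (H 0) G) {δ : ℝ≥0∞}
    (hδ : ∀ A, MeasurableSet A → ∫⁻ x in A, F x ∂ρ ≤ ∫⁻ x in A, G x ∂ρ + δ)
    (hδ' : ∀ A, MeasurableSet A → ∫⁻ x in A, G x ∂ρ ≤ ∫⁻ x in A, F x ∂ρ + δ) (T : ℕ) :
    greedyCoupling ρ H F G T {p | p.1 ≠ p.2} ≤ (2 * T - 1 : ℕ) * δ := by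
  have hD : MeasurableSet {p : Ω × Ω | p.1 ≠ p.2} :=
    (measurableSet_eq_fun measurable_fst measurable_snd).compl
  have hpart : ∀ s, decouplingPart ρ H F G s {p | p.1 ≠ p.2} ≤ ∫⁻ x, excess ρ H F G s x ∂ρ := by
    intro s
    have h := lintegral_decouplingPart_of_adaptedTo (ρ := ρ) (s := s) hH hF hG hF1 hG1 h0
      (measurable_const (a := (1 : ℝ≥0∞))) (.const 1)
    simp only [mul_one, one_mul, lintegral_const] at h
    rw [← h]
    exact measure_mono (Set.subset_univ _)
  have hstep : ∀ s, ∫⁻ x, excess ρ H F G s x ∂ρ ≤ 2 * δ := by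
    intro s
    rw [two_mul]
    exact (lintegral_excess_le hH hF hG hF1 s).trans
      (add_le_add (lintegral_cexp_sub_le hH hF hG hG1 hδ (s + 1))
        ((lintegral_surv_sub_mul_le hF1 hG1 h0 s).trans
          (lintegral_cexp_sub_le hH hG hF hF1 hδ' s)))
  have hfirst : ∫⁻ x, excess ρ H F G 0 x ∂ρ ≤ δ := by
    refine (lintegral_excess_le hH hF hG hF1 0).trans ?_
    simpa [surv, survival_zero] using lintegral_cexp_sub_le hH hF hG hG1 hδ 1
  rw [greedyCoupling, Measure.add_apply, Measure.map_apply (by fun_prop) hD,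
    Measure.finsetSum_apply]
  have hempty : (fun x : Ω => (x, x)) ⁻¹' {p | p.1 ≠ p.2} = ∅ := by ext; simp
  rw [hempty, measure_empty, zero_add]
  cases T with
  | zero => simp
  | succ T =>
    rw [Finset.sum_range_succ']
    calc _ ≤ ∑ s ∈ Finset.range T, 2 * δ + δ :=
          add_le_add (Finset.sum_le_sum fun s _ => (hpart _).trans (hstep _))
            ((hpart 0).trans hfirst)
      _ = (2 * (T + 1) - 1 : ℕ) * δ := by
          rw [show 2 * (T + 1) - 1 = 2 * T + 1 by omega]
          simp only [Finset.sum_const, Finset.card_range, nsmul_eq_mul]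
          push_cast
          ring

lemma map_fst_greedyCoupling (hH : IsProjFiltration H) (hF : Measurable F)
    (hG : Measurable G) (hF1 : ∀ x, F x ≤ 1) (hG1 : ∀ x, G x ≤ 1)
    (h0 : cexp ρ (H 0) F =ᵐ[ρ] cexp ρ (H 0) G) (T : ℕ) :
    (greedyCoupling ρ H F G T).map Prod.fst = ρ.withDensity F := by
  ext A hA
  have h := lintegral_greedyCoupling (ρ := ρ) (T := T) hH hF hG hF1 hG1 h0 (Nat.zero_le T)
    (measurable_const.indicator hA : Measurable (A.indicator fun _ => (1 : ℝ≥0∞))) (.const 1)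
  have hcond : ∀ x, greedyCond ρ H F G 0 (fun _ => 1) x = 1 := by
    intro x
    simp [greedyCond, surv, survival_zero]
  simp only [hcond, mul_one] at h
  rw [Measure.map_apply measurable_fst hA, withDensity_apply _ hA, ← lintegral_indicator hA,
    ← lintegral_indicator_one (measurable_fst hA)]
  refine (lintegral_congr fun p => ?_).trans (h.trans (lintegral_congr fun x => ?_))
  · by_cases hp : p.1 ∈ A <;> simp [hp]
  · by_cases hx : x ∈ A <;> simp [hx]

lemma exists_lintegral_greedyCoupling (hH : IsProjFiltration H) (hF : Measurable F)
    (hG : Measurable G) (hF1 : ∀ x, F x ≤ 1) (hG1 : ∀ x, G x ≤ 1)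
    (h0 : cexp ρ (H 0) F =ᵐ[ρ] cexp ρ (H 0) G) {t T : ℕ} (htT : t ≤ T)
    {φ : Ω → ℝ≥0∞} (hφ : AdaptedTo (H t) φ) :
    ∃ ψ, AdaptedTo (H t) ψ ∧ ∀ h, Measurable h →
      ∫⁻ p, h p.1 * φ p.2 ∂(greedyCoupling ρ H F G T) =
        ∫⁻ p, h p.1 * ψ p.1 ∂(greedyCoupling ρ H F G T) := by
  have hψ := adaptedTo_greedyCond (ρ := ρ) hH hF hG hφ
  refine ⟨_, hψ, fun h hh => ?_⟩
  have hm : Measurable fun x => h x * greedyCond ρ H F G t φ x := hh.mul hψ.1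
  rw [lintegral_greedyCoupling hH hF hG hF1 hG1 h0 htT hh hφ,
    ← lintegral_map (μ := greedyCoupling ρ H F G T) hm measurable_fst,
    map_fst_greedyCoupling hH hF hG hF1 hG1 h0,
    lintegral_withDensity_eq_lintegral_mul _ hF hm]
  exact lintegral_congr fun x => mul_comm _ _

lemma map_swap_greedyCoupling (hH : IsProjFiltration H) (hF : Measurable F)
    (hG : Measurable G) (hF1 : ∀ x, F x ≤ 1) (hG1 : ∀ x, G x ≤ 1)
    (h0 : cexp ρ (H 0) F =ᵐ[ρ] cexp ρ (H 0) G) {T : ℕ} (hT : ∀ x, H T x = x) :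
    (greedyCoupling ρ H F G T).map Prod.swap = greedyCoupling ρ H G F T := by
  have : IsFiniteMeasure (greedyCoupling ρ H G F T) := by
    have : IsFiniteMeasure (ρ.withDensity G) :=
      isFiniteMeasure_withDensity (ne_top_of_le_ne_top (by simp) (lintegral_mono hG1))
    refine ⟨?_⟩
    have h := congrArg (fun m => m Set.univ)
      (map_fst_greedyCoupling (ρ := ρ) hH hG hF hG1 hF1 h0.symm T)
    simp only [Measure.map_apply measurable_fst MeasurableSet.univ, Set.preimage_univ] at h
    rw [h]
    exact measure_lt_top _ _
  symm
  refine Measure.ext_prod fun {A B} hA hB => ?_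
  have h := lintegral_greedyCoupling_swap (ρ := ρ) hH hF hG hF1 hG1 h0 hT
    (measurable_const.indicator hA : Measurable (A.indicator fun _ => (1 : ℝ≥0∞)))
    (measurable_const.indicator hB : Measurable (B.indicator fun _ => (1 : ℝ≥0∞)))
  rw [Measure.map_apply measurable_swap (hA.prod hB), ← lintegral_indicator_one (hA.prod hB),
    ← lintegral_indicator_one (measurable_swap (hA.prod hB))]
  refine (lintegral_congr fun p => ?_).trans (h.symm.trans (lintegral_congr fun p => ?_))
  · by_cases h1 : p.1 ∈ A <;> by_cases h2 : p.2 ∈ B <;> simp [h1, h2, Set.indicator]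
  · by_cases h1 : p.1 ∈ B <;> by_cases h2 : p.2 ∈ A <;> simp [h1, h2, Set.indicator]

end Greedy

/-- If two probability measures differ by at most `δ` on every event, there is a coupling of them
which is causal in both directions for the given filtration and puts mass at most
`(2 T - 1) δ` off the diagonal. -/
theorem exists_bicausal_coupling (μ ν : Measure Ω) [IsProbabilityMeasure μ]
    [IsProbabilityMeasure ν] {H : ℕ → Ω → Ω} (hH : IsProjFiltration H)
    (hconst : ∀ x y, H 0 x = H 0 y) {T : ℕ} (hT : ∀ x, H T x = x) {δ : ℝ≥0∞}
    (hδ : ∀ A, MeasurableSet A → μ A ≤ ν A + δ) (hδ' : ∀ A, MeasurableSet A → ν A ≤ μ A + δ) :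
    ∃ π : Measure (Ω × Ω), π.map Prod.fst = μ ∧ π.map Prod.snd = ν ∧
      (∀ t ≤ T, ∀ φ, AdaptedTo (H t) φ → ∃ ψ, AdaptedTo (H t) ψ ∧ ∀ h, Measurable h →
        ∫⁻ p, h p.1 * φ p.2 ∂π = ∫⁻ p, h p.1 * ψ p.1 ∂π) ∧
      (∀ t ≤ T, ∀ φ, AdaptedTo (H t) φ → ∃ ψ, AdaptedTo (H t) ψ ∧ ∀ h, Measurable h →
        ∫⁻ p, h p.1 * φ p.2 ∂(π.map Prod.swap) = ∫⁻ p, h p.1 * ψ p.1 ∂(π.map Prod.swap)) ∧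
      π {p | p.1 ≠ p.2} ≤ (2 * T - 1 : ℕ) * δ := by
  obtain ⟨F, hF, hF1, hFμ⟩ := exists_density_le_one (ρ := μ + ν) (Measure.le_add_right le_rfl)
  obtain ⟨G, hG, hG1, hGν⟩ := exists_density_le_one (ρ := μ + ν) (Measure.le_add_left le_rfl)
  have hFA : ∀ A, MeasurableSet A → ∫⁻ x in A, F x ∂(μ + ν) = μ A := fun A hA => by
    rw [← withDensity_apply _ hA, hFμ]
  have hGA : ∀ A, MeasurableSet A → ∫⁻ x in A, G x ∂(μ + ν) = ν A := fun A hA => by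
    rw [← withDensity_apply _ hA, hGν]
  have h0 : cexp (μ + ν) (H 0) F =ᵐ[μ + ν] cexp (μ + ν) (H 0) G := by
    refine AdaptedTo.ae_eq (hH.measurable 0) (hH.idem 0)
      (adaptedTo_cexp (hH.measurable 0) (hH.idem 0) hF)
      (adaptedTo_cexp (hH.measurable 0) (hH.idem 0) hG) fun w hw _ => ?_
    rw [lintegral_mul_cexp (hH.measurable 0) hw hF,
      lintegral_mul_cexp (hH.measurable 0) hw hG]
    have hwc : ∀ x, w x = w (Classical.arbitrary Ω) := fun x => by
      rw [← hw.2 x, hconst x (Classical.arbitrary Ω), hw.2]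
    simp_rw [hwc]
    have h1 := hFA _ MeasurableSet.univ
    have h2 := hGA _ MeasurableSet.univ
    rw [measure_univ, setLIntegral_univ] at h1 h2
    rw [lintegral_const_mul _ hF, lintegral_const_mul _ hG, h1, h2]
  have hswap := map_swap_greedyCoupling hH hF hG hF1 hG1 h0 hT
  refine ⟨greedyCoupling (μ + ν) H F G T, ?_, ?_, ?_, ?_, ?_⟩
  · rw [map_fst_greedyCoupling hH hF hG hF1 hG1 h0, hFμ]
  · have h := map_fst_greedyCoupling hH hG hF hG1 hF1 h0.symm T
    rw [← hswap, Measure.map_map measurable_fst measurable_swap, hGν] at h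
    exact h
  · exact fun t ht φ hφ => exists_lintegral_greedyCoupling hH hF hG hF1 hG1 h0 ht hφ
  · rw [hswap]
    exact fun t ht φ hφ => exists_lintegral_greedyCoupling hH hG hF hG1 hF1 h0.symm ht hφ
  · refine greedyCoupling_ne_le hH hF hG hF1 hG1 h0 (fun A hA => ?_) (fun A hA => ?_) T
    · rw [hFA A hA, hGA A hA]
      exact hδ A hA
    · rw [hFA A hA, hGA A hA]
      exact hδ' A hA

end Projections

section Causality

variable {Ω : Type*} [MeasurableSpace Ω] {π : Measure (Ω × Ω)} [IsFiniteMeasure π]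

lemma setIntegral_toReal_sub_eq {f : Ω → ℝ} (hf : Measurable f) {C : ℝ} (hC : ∀ y, |f y| ≤ C)
    {ψ : Ω → ℝ≥0∞} (hψ : Measurable ψ)
    (hfψ : ∀ h, Measurable h →
      ∫⁻ p, h p.1 * ENNReal.ofReal (f p.2 + C) ∂π = ∫⁻ p, h p.1 * ψ p.1 ∂π) :
    Integrable (fun p => f p.2) π ∧ Integrable (fun p => (ψ p.1).toReal - C) π ∧
      ∀ A, MeasurableSet A → ∫ p in Prod.fst ⁻¹' A, ((ψ p.1).toReal - C) ∂π =
        ∫ p in Prod.fst ⁻¹' A, f p.2 ∂π := by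
  have hψ1 : Measurable fun p : Ω × Ω => ψ p.1 := hψ.comp measurable_fst
  have hf1 : Measurable fun p : Ω × Ω => f p.2 := hf.comp measurable_snd
  have hfin : ∫⁻ p, ψ p.1 ∂π ≠ ∞ := by
    have h1 := hfψ (fun _ => 1) measurable_const
    simp only [one_mul] at h1
    rw [← h1]
    refine ne_top_of_le_ne_top (b := ∫⁻ _, ENNReal.ofReal (C + C) ∂π) ?_
      (lintegral_mono fun p => ENNReal.ofReal_le_ofReal ?_)
    · rw [lintegral_const]
      exact ENNReal.mul_ne_top ofReal_ne_top (measure_ne_top _ _)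
    · gcongr
      exact (le_abs_self _).trans (hC _)
  have hψint : Integrable (fun p => (ψ p.1).toReal) π :=
    integrable_toReal_of_lintegral_ne_top hψ1.aemeasurable hfin
  have hfint : Integrable (fun p => f p.2) π :=
    .of_bound hf1.aestronglyMeasurable C (.of_forall fun p => by simpa using hC p.2)
  refine ⟨hfint, hψint.sub (integrable_const C), fun A hA => ?_⟩
  have hA1 : MeasurableSet (Prod.fst ⁻¹' A : Set (Ω × Ω)) := measurable_fst hA
  have hind : ∀ k : Ω × Ω → ℝ≥0∞, ∫⁻ p, A.indicator (fun _ => 1) p.1 * k p ∂π =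
      ∫⁻ p in Prod.fst ⁻¹' A, k p ∂π := by
    intro k
    rw [← lintegral_indicator hA1]
    refine lintegral_congr fun p => ?_
    by_cases hp : p.1 ∈ A <;> simp [hp]
  have h1 := hfψ (A.indicator fun _ => 1) (measurable_const.indicator hA)
  rw [hind, hind] at h1
  have key : ∫ p in Prod.fst ⁻¹' A, (ψ p.1).toReal ∂π =
      ∫ p in Prod.fst ⁻¹' A, (f p.2 + C) ∂π := by
    rw [integral_toReal hψ1.aemeasurable (ae_restrict_of_ae (ae_lt_top hψ1 hfin)), ← h1,
      integral_eq_lintegral_of_nonneg_ae (.of_forall fun p => ?_)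
        (hf1.add_const C).aestronglyMeasurable]
    have := neg_le_of_abs_le (hC p.2)
    change 0 ≤ f p.2 + C
    linarith
  rw [integral_sub hψint.integrableOn (integrable_const C), key,
    integral_add hfint.integrableOn (integrable_const C), add_sub_cancel_right]

lemma ae_eq_condExp_snd {f : Ω → ℝ} (hf : Measurable f) {C : ℝ} (hC : ∀ y, |f y| ≤ C)
    {ψ : Ω → ℝ≥0∞} (hψ : Measurable ψ)
    (hfψ : ∀ h, Measurable h →
      ∫⁻ p, h p.1 * ENNReal.ofReal (f p.2 + C) ∂π = ∫⁻ p, h p.1 * ψ p.1 ∂π)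
    {m : MeasurableSpace (Ω × Ω)} (hm : m ≤ MeasurableSpace.comap Prod.fst inferInstance)
    (hψm : Measurable[m] fun p : Ω × Ω => ψ p.1) :
    (fun p => (ψ p.1).toReal - C) =ᵐ[π] π[(fun p => f p.2) | m] := by
  obtain ⟨hfint, hψint, h⟩ := setIntegral_toReal_sub_eq hf hC hψ hfψ
  refine ae_eq_condExp_of_forall_setIntegral_eq (hm.trans measurable_fst.comap_le) hfint
    (fun s _ _ => hψint.integrableOn) (fun s hs _ => ?_) ?_
  · obtain ⟨A, hA, rfl⟩ := hm s hs
    exact h A hA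
  · exact (hψm.ennreal_toReal.sub_const C).aestronglyMeasurable

/-- If conditional expectations of functions adapted to `H` are adapted to `H`, then the
conditional law of `H y` given `x` depends only on `H x`. -/
lemma condExp_snd_comap_ae_eq {H : Ω → Ω} (hH : Measurable H)
    (hπ : ∀ φ, AdaptedTo H φ → ∃ ψ, AdaptedTo H ψ ∧ ∀ h, Measurable h →
      ∫⁻ p, h p.1 * φ p.2 ∂π = ∫⁻ p, h p.1 * ψ p.1 ∂π)
    {f : Ω → ℝ} (hf : Measurable f) (hfH : ∀ y, f (H y) = f y) {C : ℝ} (hC : ∀ y, |f y| ≤ C) :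
    π[(fun p => f p.2) | MeasurableSpace.comap Prod.fst inferInstance]
      =ᵐ[π] π[(fun p => f p.2) | MeasurableSpace.comap (fun p => H p.1) inferInstance] := by
  obtain ⟨ψ, hψ, h⟩ := hπ (fun y => ENNReal.ofReal (f y + C))
    ⟨(hf.add_const C).ennreal_ofReal, fun y => by simp only [hfH]⟩
  refine (ae_eq_condExp_snd hf hC hψ.1 h le_rfl ?_).symm.trans
    (ae_eq_condExp_snd hf hC hψ.1 h ?_ ?_)
  · exact hψ.1.comp (comap_measurable _)
  · exact (hH.comp (comap_measurable Prod.fst)).comap_le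
  · have e : (fun p : Ω × Ω => ψ p.1) = fun p => ψ (H p.1) := by simp only [hψ.2]
    rw [e]
    exact hψ.1.comp (comap_measurable fun p : Ω × Ω => H p.1)

end Causality

section PathSpace

variable {d T : ℕ}

lemma isProjFiltration_hist : IsProjFiltration (hist : ℕ → TPath d T → TPath d T) where
  measurable t := by
    refine measurable_pi_lambda _ fun s => ?_
    by_cases h : (s : ℕ) < t
    · simpa [hist, h] using measurable_pi_apply s
    · simp [hist, h]
  comp s t hst x := by
    funext r
    by_cases h : (r : ℕ) < s
    · simp [hist, h, h.trans_le hst]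
    · simp [hist, h]

lemma hist_self (x : TPath d T) : hist T x = x := by
  funext r
  simp [hist]

/-- Two path laws differing by at most `δ` on every event have a bicausal coupling whose mass off
the diagonal is at most `(2 T - 1) δ`. -/
theorem exists_isBicausalCoupling (μ ν : Measure (TPath d T)) [IsProbabilityMeasure μ]
    [IsProbabilityMeasure ν] {δ : ℝ≥0∞}
    (hδ : ∀ A, MeasurableSet A → μ A ≤ ν A + δ) (hδ' : ∀ A, MeasurableSet A → ν A ≤ μ A + δ) :
    ∃ π : Measure (TPath d T × TPath d T), IsCoupling μ ν π ∧ IsBicausalCoupling π ∧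
      π {p | p.1 ≠ p.2} ≤ (2 * T - 1 : ℕ) * δ := by
  obtain ⟨π, h1, h2, hc, hc', hne⟩ := exists_bicausal_coupling μ ν isProjFiltration_hist
    (fun x y => by funext r; simp [hist]) hist_self hδ hδ'
  have : IsProbabilityMeasure (π.map Prod.fst) := h1 ▸ ‹_›
  have : IsProbabilityMeasure π := Measure.isProbabilityMeasure_of_map Prod.fst
  have : IsProbabilityMeasure (π.map Prod.swap) :=
    Measure.isProbabilityMeasure_map measurable_swap.aemeasurable
  exact ⟨π, ⟨h1, h2⟩,
    ⟨fun t ht f hf hft ⟨_, hC⟩ =>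
      condExp_snd_comap_ae_eq (isProjFiltration_hist.measurable t) (hc t ht.le) hf hft hC,
    fun t ht f hf hft ⟨_, hC⟩ =>
      condExp_snd_comap_ae_eq (isProjFiltration_hist.measurable t) (hc' t ht.le) hf hft hC⟩, hne⟩

lemma IsCoupling.isProbabilityMeasure {μ ν : Measure (TPath d T)} [h : IsProbabilityMeasure μ]
    {π : Measure (TPath d T × TPath d T)} (hπ : IsCoupling μ ν π) : IsProbabilityMeasure π := by
  have : IsProbabilityMeasure (π.map Prod.fst) := hπ.1 ▸ h
  exact Measure.isProbabilityMeasure_of_map Prod.fst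

lemma le_add_measure_ne {Ω : Type*} [MeasurableSpace Ω] {μ ν : Measure Ω} {π : Measure (Ω × Ω)}
    (h1 : π.map Prod.fst = μ) (h2 : π.map Prod.snd = ν) {A : Set Ω} (hA : MeasurableSet A) :
    μ A ≤ ν A + π {p | p.1 ≠ p.2} := by
  rw [← h1, ← h2, Measure.map_apply measurable_fst hA, Measure.map_apply measurable_snd hA]
  refine (measure_mono fun p hp => ?_).trans (measure_union_le _ _)
  by_cases h : p.1 = p.2
  · exact .inl (by simpa [← h] using hp)
  · exact .inr h

lemma le_add_measure_ne' {Ω : Type*} [MeasurableSpace Ω] {μ ν : Measure Ω} {π : Measure (Ω × Ω)}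
    (h1 : π.map Prod.fst = μ) (h2 : π.map Prod.snd = ν) {A : Set Ω} (hA : MeasurableSet A) :
    ν A ≤ μ A + π {p | p.1 ≠ p.2} := by
  rw [← h1, ← h2, Measure.map_apply measurable_fst hA, Measure.map_apply measurable_snd hA]
  refine (measure_mono fun p hp => ?_).trans (measure_union_le _ _)
  by_cases h : p.1 = p.2
  · exact .inl (by simpa [h] using hp)
  · exact .inr h

lemma eNorm_eq_norm (v : Fin d → ℝ) : eNorm v = ‖WithLp.toLp 2 v‖ := by
  simp [eNorm, EuclideanSpace.norm_eq]

lemma eNorm_sub_le (v w : Fin d → ℝ) : eNorm (v - w) ≤ eNorm v + eNorm w := by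
  simp only [eNorm_eq_norm, WithLp.toLp_sub]
  exact norm_sub_le _ _

lemma pathNorm_nonneg (x : TPath d T) : 0 ≤ pathNorm x :=
  Finset.sum_nonneg fun _ _ => Real.sqrt_nonneg _

lemma pathNorm_sub_le (x y : TPath d T) : pathNorm (x - y) ≤ pathNorm x + pathNorm y := by
  simp only [pathNorm, ← Finset.sum_add_distrib]
  exact Finset.sum_le_sum fun t _ => eNorm_sub_le _ _

lemma pathNorm_zero : pathNorm (0 : TPath d T) = 0 := by
  simp [pathNorm, eNorm]

lemma integral_pathNorm_sub_le {μ ν : Measure (TPath d T)} [IsProbabilityMeasure μ]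
    (hμ : ∀ᵐ x ∂μ, pathNorm x ≤ 1) (hν : ∀ᵐ x ∂ν, pathNorm x ≤ 1)
    {π : Measure (TPath d T × TPath d T)} (hπ : IsCoupling μ ν π) :
    ∫ p, pathNorm (p.1 - p.2) ∂π ≤ 2 * (π {p | p.1 ≠ p.2}).toReal := by
  have := hπ.isProbabilityMeasure
  have hD : MeasurableSet {p : TPath d T × TPath d T | p.1 ≠ p.2} :=
    (measurableSet_eq_fun measurable_fst measurable_snd).compl
  rw [← hπ.1] at hμ
  rw [← hπ.2] at hν
  calc ∫ p, pathNorm (p.1 - p.2) ∂π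
      ≤ ∫ p, {p : TPath d T × TPath d T | p.1 ≠ p.2}.indicator (fun _ => (2 : ℝ)) p ∂π := by
        refine integral_mono_of_nonneg (.of_forall fun p => pathNorm_nonneg _)
          ((integrable_const _).indicator hD) ?_
        filter_upwards [ae_of_ae_map measurable_fst.aemeasurable hμ,
          ae_of_ae_map measurable_snd.aemeasurable hν] with p h1 h2
        by_cases h : p.1 = p.2
        · simp [h, pathNorm_zero]
        · simpa [h] using (pathNorm_sub_le p.1 p.2).trans (by linarith)
    _ = 2 * (π {p | p.1 ≠ p.2}).toReal := by
        rw [integral_indicator_const _ hD, smul_eq_mul, mul_comm, measureReal_def]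

end PathSpace

section Pinsker

variable {Ω : Type*} [MeasurableSpace Ω] {μ ν : Measure Ω} [IsProbabilityMeasure μ]
  [IsProbabilityMeasure ν]

/-- Pinsker's inequality on a single event. -/
lemma two_mul_sq_measureReal_sub_le (hμν : μ ≪ ν) (hint : Integrable (llr μ ν) μ) {A : Set Ω}
    (hA : MeasurableSet A) : 2 * (μ.real A - ν.real A) ^ 2 ≤ ∫ x, llr μ ν x ∂μ := by
  set X : Ω → ℝ := A.indicator fun _ => 1
  have hX : Measurable X := measurable_const.indicator hA
  have hX01 : ∀ x, X x ∈ Set.Icc (0 : ℝ) 1 := fun x => by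
    by_cases hx : x ∈ A <;> simp [X, hx]
  have hmean : ∀ (m : Measure Ω), ∫ x, X x ∂m = m.real A := fun m => by
    simp [X, integral_indicator_const _ hA]
  have hXint : Integrable X μ := (integrable_const (1 : ℝ)).indicator hA
  have hsub := hasSubgaussianMGF_of_mem_Icc (μ := ν) hX.aemeasurable (.of_forall hX01)
  rw [hmean] at hsub
  set s : ℝ := 4 * (μ.real A - ν.real A) with hs
  have hexp := hsub.integrable_exp_mul s
  have hfint : Integrable (fun x => s * (X x - ν.real A)) μ :=
    (hXint.sub (integrable_const _)).const_mul s
  have := isProbabilityMeasure_tilted hexp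
  have h1 := InformationTheory.integral_llr_add_sub_measure_univ_nonneg
    (hμν.trans (absolutelyContinuous_tilted hexp))
    (integrable_llr_tilted_right hμν hfint hint hexp)
  have h2 := hsub.cgf_le s
  rw [integral_llr_tilted_right hμν hfint hexp hint, integral_const_mul,
    integral_sub hXint (integrable_const _), hmean] at h1
  simp only [integral_const, probReal_univ, smul_eq_mul, one_mul, add_sub_cancel_right] at h1
  rw [cgf, mgf] at h2
  norm_num at h2
  nlinarith [h1, h2, hs]

lemma measure_le_add_sqrt_integral_llr (hμν : μ ≪ ν) (hint : Integrable (llr μ ν) μ) {A : Set Ω}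
    (hA : MeasurableSet A) :
    μ A ≤ ν A + ENNReal.ofReal (Real.sqrt (2⁻¹ * ∫ x, llr μ ν x ∂μ)) ∧
      ν A ≤ μ A + ENNReal.ofReal (Real.sqrt (2⁻¹ * ∫ x, llr μ ν x ∂μ)) := by
  have h : |μ.real A - ν.real A| ≤ Real.sqrt (2⁻¹ * ∫ x, llr μ ν x ∂μ) :=
    Real.abs_le_sqrt (by linarith [two_mul_sq_measureReal_sub_le hμν hint hA])
  rw [abs_le] at h
  rw [← ofReal_measureReal (μ := μ) (s := A), ← ofReal_measureReal (μ := ν) (s := A),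
    ← ENNReal.ofReal_add measureReal_nonneg (Real.sqrt_nonneg _),
    ← ENNReal.ofReal_add measureReal_nonneg (Real.sqrt_nonneg _)]
  exact ⟨ENNReal.ofReal_le_ofReal (by linarith), ENNReal.ofReal_le_ofReal (by linarith)⟩

/-- Existence of a maximal coupling. -/
lemma exists_coupling_ne_le [StandardBorelSpace Ω] {δ : ℝ≥0∞}
    (hδ : ∀ A, MeasurableSet A → μ A ≤ ν A + δ) (hδ' : ∀ A, MeasurableSet A → ν A ≤ μ A + δ) :
    ∃ π : Measure (Ω × Ω), π.map Prod.fst = μ ∧ π.map Prod.snd = ν ∧ π {p | p.1 ≠ p.2} ≤ δ := by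
  have : Nonempty Ω := nonempty_of_isProbabilityMeasure μ
  let H : ℕ → Ω → Ω := fun t => if t = 0 then fun _ => Classical.arbitrary Ω else id
  have hH : IsProjFiltration H :=
    ⟨fun t => by by_cases ht : t = 0 <;> simp [H, ht, measurable_id],
      fun s t hst x => by
        by_cases ht : t = 0
        · simp [H, ht, Nat.le_zero.1 (ht ▸ hst)]
        · simp [H, ht]⟩
  obtain ⟨π, h1, h2, -, -, hne⟩ := exists_bicausal_coupling μ ν hH (fun _ _ => rfl) (T := 1)
    (fun _ => rfl) hδ hδ'
  exact ⟨π, h1, h2, by simpa using hne⟩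

end Pinsker

section Comparison

variable {d T : ℕ} {μ ν : Measure (TPath d T)}

lemma TV0_le_of_isCoupling {π : Measure (TPath d T × TPath d T)} (hπ : IsCoupling μ ν π) :
    TV0 μ ν ≤ (π {p | p.1 ≠ p.2}).toReal :=
  csInf_le ⟨0, by rintro _ ⟨_, _, rfl⟩; exact toReal_nonneg⟩ ⟨π, hπ, rfl⟩

lemma AV0_le_of_isCoupling {π : Measure (TPath d T × TPath d T)} (hπ : IsCoupling μ ν π)
    (hbc : IsBicausalCoupling π) : AV0 μ ν ≤ (π {p | p.1 ≠ p.2}).toReal :=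
  csInf_le ⟨0, by rintro _ ⟨_, _, _, rfl⟩; exact toReal_nonneg⟩ ⟨π, hπ, hbc, rfl⟩

lemma AW1_le_of_isCoupling {π : Measure (TPath d T × TPath d T)} (hπ : IsCoupling μ ν π)
    (hbc : IsBicausalCoupling π) : AW1 μ ν ≤ ∫ p, pathNorm (p.1 - p.2) ∂π :=
  csInf_le ⟨0, by rintro _ ⟨_, _, _, rfl⟩; exact integral_nonneg fun _ => pathNorm_nonneg _⟩
    ⟨π, hπ, hbc, rfl⟩

lemma CW1_le_of_isCoupling {π : Measure (TPath d T × TPath d T)} (hπ : IsCoupling μ ν π)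
    (hc : IsCausalCoupling π) : CW1 μ ν ≤ ∫ p, pathNorm (p.1 - p.2) ∂π :=
  csInf_le ⟨0, by rintro _ ⟨_, _, _, rfl⟩; exact integral_nonneg fun _ => pathNorm_nonneg _⟩
    ⟨π, hπ, hc, rfl⟩

variable [IsProbabilityMeasure μ] [IsProbabilityMeasure ν]

variable (μ ν) in
lemma exists_isCoupling_isBicausalCoupling :
    ∃ π : Measure (TPath d T × TPath d T), IsCoupling μ ν π ∧ IsBicausalCoupling π :=
  let ⟨π, h, hbc, _⟩ := exists_isBicausalCoupling (μ := μ) (ν := ν) (δ := 1)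
    (fun _ _ => prob_le_one.trans le_add_self) (fun _ _ => prob_le_one.trans le_add_self)
  ⟨π, h, hbc⟩

lemma two_mul_sub_one_le_two_pow_sub_one (n : ℕ) : ((2 * n - 1 : ℕ) : ℝ) ≤ 2 ^ n - 1 := by
  have h : 2 * n - 1 + 1 ≤ 2 ^ n := by
    induction n with
    | zero => simp
    | succ n ih =>
      have := n.one_le_two_pow
      rw [pow_succ]
      omega
  have h' : ((2 * n - 1 : ℕ) : ℝ) + 1 ≤ 2 ^ n := by exact_mod_cast h
  linarith

lemma CW1_le_AW1 : CW1 μ ν ≤ AW1 μ ν := by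
  obtain ⟨π, hπ, hbc⟩ := exists_isCoupling_isBicausalCoupling μ ν
  refine le_csInf ⟨_, π, hπ, hbc, rfl⟩ ?_
  rintro _ ⟨π, hπ, hbc, rfl⟩
  exact CW1_le_of_isCoupling hπ hbc.1

lemma AW1_le_two_mul_AV0 (hμ : ∀ᵐ x ∂μ, pathNorm x ≤ 1) (hν : ∀ᵐ x ∂ν, pathNorm x ≤ 1) :
    AW1 μ ν ≤ 2 * AV0 μ ν := by
  obtain ⟨π, hπ, hbc⟩ := exists_isCoupling_isBicausalCoupling μ ν
  rw [← div_le_iff₀' two_pos]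
  refine le_csInf ⟨_, π, hπ, hbc, rfl⟩ ?_
  rintro _ ⟨π, hπ, hbc, rfl⟩
  rw [div_le_iff₀' two_pos]
  exact (AW1_le_of_isCoupling hπ hbc).trans (integral_pathNorm_sub_le hμ hν hπ)

lemma AV0_le_mul_TV0 : AV0 μ ν ≤ (2 ^ T - 1) * TV0 μ ν := by
  obtain ⟨π₀, hπ₀, -⟩ := exists_isCoupling_isBicausalCoupling μ ν
  have hT : (0 : ℝ) ≤ 2 ^ T - 1 := sub_nonneg.2 (one_le_pow₀ one_le_two)
  have key : ∀ γ, IsCoupling μ ν γ → AV0 μ ν ≤ (2 ^ T - 1) * (γ {p | p.1 ≠ p.2}).toReal := by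
    intro γ hγ
    have := hγ.isProbabilityMeasure
    obtain ⟨π, hπ, hbc, hne⟩ := exists_isBicausalCoupling μ ν
      (fun _ => le_add_measure_ne hγ.1 hγ.2) (fun _ => le_add_measure_ne' hγ.1 hγ.2)
    refine (AV0_le_of_isCoupling hπ hbc).trans ?_
    refine (toReal_mono (mul_ne_top (natCast_ne_top _) (measure_ne_top _ _)) hne).trans ?_
    rw [toReal_mul, toReal_natCast]
    gcongr
    exact two_mul_sub_one_le_two_pow_sub_one T
  rcases hT.eq_or_lt with h0 | hpos
  · simpa [← h0] using key π₀ hπ₀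
  · rw [← div_le_iff₀' hpos]
    refine le_csInf ⟨_, π₀, hπ₀, rfl⟩ ?_
    rintro _ ⟨γ, hγ, rfl⟩
    rw [div_le_iff₀' hpos]
    exact key γ hγ

lemma TV0_le_sqrt_integral_llr (hμν : μ ≪ ν) (hint : Integrable (llr μ ν) μ) :
    TV0 μ ν ≤ Real.sqrt (2⁻¹ * ∫ x, llr μ ν x ∂μ) := by
  obtain ⟨π, h1, h2, hne⟩ := exists_coupling_ne_le
    (fun A hA => (measure_le_add_sqrt_integral_llr hμν hint (A := A) hA).1)
    (fun A hA => (measure_le_add_sqrt_integral_llr hμν hint (A := A) hA).2)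
  exact (TV0_le_of_isCoupling ⟨h1, h2⟩).trans
    (toReal_le_of_le_ofReal (Real.sqrt_nonneg _) hne)

lemma ofReal_mul_TV0_le {C : ℝ} (hC : 0 ≤ C) :
    ENNReal.ofReal (C * TV0 μ ν) ≤
      ENNReal.ofReal C * (2⁻¹ * KLDiv μ ν) ^ (2⁻¹ : ℝ) := by
  rcases hC.eq_or_lt with rfl | hpos
  · simp
  rw [ENNReal.ofReal_mul hC]
  gcongr
  by_cases h : μ ≪ ν ∧ Integrable (llr μ ν) μ
  · have h2 : (2⁻¹ : ℝ≥0∞) = ENNReal.ofReal 2⁻¹ := by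
      rw [ENNReal.ofReal_inv_of_pos two_pos, ENNReal.ofReal_ofNat]
    have hKL : 0 ≤ ∫ x, llr μ ν x ∂μ := by
      have := two_mul_sq_measureReal_sub_le h.1 h.2 MeasurableSet.empty
      simpa using this
    rw [KLDiv, if_pos h, h2, ← ENNReal.ofReal_mul (by norm_num),
      ENNReal.ofReal_rpow_of_nonneg (by positivity) (by norm_num)]
    refine ENNReal.ofReal_le_ofReal ((TV0_le_sqrt_integral_llr h.1 h.2).trans_eq ?_)
    rw [Real.sqrt_eq_rpow, one_div]
  · rw [KLDiv, if_neg h, ENNReal.mul_top (by simp), ENNReal.top_rpow_of_pos (by norm_num)]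
    exact le_top

end Comparison

/-- Ordering of distances: `CW₁ ≤ AW₁ ≤ 2·AV₀ ≤ C·TV₀ ≤ C·√(KL/2)` on the unit ball,
with `C = 2(2^T − 1)`. -/
theorem stmt0 (d T : ℕ) (μ ν : Measure (TPath d T))
    [IsProbabilityMeasure μ] [IsProbabilityMeasure ν]
    (hμ : ∀ᵐ x ∂μ, pathNorm x ≤ 1) (hν : ∀ᵐ x ∂ν, pathNorm x ≤ 1) :
    CW1 μ ν ≤ AW1 μ ν ∧
    AW1 μ ν ≤ 2 * AV0 μ ν ∧
    2 * AV0 μ ν ≤ (2 * (2 ^ T - 1)) * TV0 μ ν ∧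
    ENNReal.ofReal ((2 * (2 ^ T - 1)) * TV0 μ ν)
      ≤ ENNReal.ofReal (2 * (2 ^ T - 1)) * (2⁻¹ * KLDiv μ ν) ^ (2⁻¹ : ℝ) := by
  have hC : (0 : ℝ) ≤ 2 * (2 ^ T - 1) :=
    mul_nonneg zero_le_two (sub_nonneg.2 (one_le_pow₀ one_le_two))
  refine ⟨CW1_le_AW1, AW1_le_two_mul_AV0 hμ hν, ?_, ofReal_mul_TV0_le hC⟩
  rw [mul_assoc]
  exact mul_le_mul_of_nonneg_left AV0_le_mul_TV0 zero_le_two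

end
end

section
/- Let d,d_Z,T ∈ ℕ, let De_θ: ℝ^{d_Z T} → ℝ^{dT} be a Borel-measurable map, let μ_latent and μ_prior be probability measures on ℝ^{d_Z T}, and set μ_rec = (De_θ)_#μ_latent and μ_gen = (De_θ)_#μ_prior. If μ_rec and μ_gen are supported in B₁ = {x ∈ ℝ^{dT} : ‖x‖ ≤ 1} (with ‖x‖ = Σ_{t=1}^T ‖x_t‖_{ℝ^d}), then CW₁(μ_rec, μ_gen) ≤ C·√((1/2)·D_KL(μ_latent | μ_prior)), where C = 2(2^T − 1). -/
open MeasureTheory ProbabilityTheory ENNReal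

noncomputable section

section Hist

variable {d T : ℕ}

lemma hist_hist (r s : ℕ) (x : TPath d T) : hist r (hist s x) = hist (min r s) x := by
  funext i
  simp only [hist, lt_min_iff]
  split_ifs <;> simp_all

lemma hist_of_le {r : ℕ} (h : T ≤ r) (x : TPath d T) : hist r x = x := by
  funext i
  simp [hist, i.isLt.trans_le h]

lemma hist_zero (x : TPath d T) : hist 0 x = 0 := by
  funext i
  simp [hist]

@[fun_prop]
lemma measurable_hist (r : ℕ) : Measurable (hist r : TPath d T → TPath d T) := by
  refine measurable_pi_lambda _ fun i => ?_
  by_cases h : (i : ℕ) < r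
  · simpa [hist, h] using measurable_pi_apply i
  · simp [hist, h]

/-- A function of `x_{1:r}` is a function of `x_{1:s}` for `r ≤ s`. -/
lemma comp_hist_of_le {β : Type*} {F : TPath d T → β} {r s : ℕ} (hrs : r ≤ s)
    (hF : ∀ x, F (hist r x) = F x) (x : TPath d T) : F (hist s x) = F x := by
  rw [← hF, hist_hist, min_eq_left hrs, hF]

/-- The path following `x` before time `t` and `y` from then on. -/
def splice (t : ℕ) (x y : TPath d T) : TPath d T :=
  fun s => if (s : ℕ) < t then x s else y s

lemma splice_hist_of_le {t r : ℕ} (h : t ≤ r) (x y : TPath d T) :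
    splice t (hist r x) y = splice t x y := by
  funext i
  simp only [splice, hist]
  split_ifs <;> first | rfl | omega

lemma splice_self (t : ℕ) (x : TPath d T) : splice t x x = x := by
  funext i
  simp [splice]

lemma hist_splice (t : ℕ) (x y : TPath d T) : hist t (splice t x y) = hist t x := by
  funext i
  simp only [splice, hist]
  split_ifs <;> rfl

@[fun_prop]
lemma measurable_splice (t : ℕ) :
    Measurable fun p : TPath d T × TPath d T => splice t p.1 p.2 := by
  refine measurable_pi_lambda _ fun i => ?_
  by_cases h : (i : ℕ) < t
  · simp only [splice, h, if_true]
    fun_prop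
  · simp only [splice, h, if_false]
    fun_prop

end Hist

section FutureKernel

variable {d T : ℕ} (ν : Measure (TPath d T)) [IsProbabilityMeasure ν] (t : ℕ)

/-- The kernel that keeps `x_{1:t}` and resamples the rest of the path from the conditional
law under `ν`. -/
def futureKernel : Kernel (TPath d T) (TPath d T) :=
  (Kernel.id ×ₖ (condDistrib id (hist t) ν).comap (hist t) (measurable_hist t)).map
    fun p => splice t p.1 p.2

instance : IsMarkovKernel (futureKernel ν t) :=
  Kernel.IsMarkovKernel.map _ (measurable_splice t)

lemma lintegral_futureKernel {F : TPath d T → ℝ≥0∞} (hF : Measurable F) (x : TPath d T) :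
    ∫⁻ y, F y ∂futureKernel ν t x
      = ∫⁻ y, F (splice t x y) ∂condDistrib id (hist t) ν (hist t x) := by
  have hFs : Measurable fun p : TPath d T × TPath d T => F (splice t p.1 p.2) := by fun_prop
  rw [futureKernel, Kernel.lintegral_map _ (measurable_splice t) _ hF,
    Kernel.lintegral_id_prod hFs]
  rfl

lemma futureKernel_hist {r : ℕ} (h : t ≤ r) (x : TPath d T) :
    futureKernel ν t (hist r x) = futureKernel ν t x := by
  refine Measure.ext_of_lintegral _ fun F hF => ?_
  rw [lintegral_futureKernel ν t hF, lintegral_futureKernel ν t hF, hist_hist, min_eq_left h]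
  simp_rw [splice_hist_of_le h]

lemma ae_futureKernel_hist_eq (x : TPath d T) :
    ∀ᵐ y ∂futureKernel ν t x, hist t y = hist t x := by
  have hs : MeasurableSet {y : TPath d T | hist t y = hist t x} :=
    measurableSet_eq_fun (measurable_hist t) measurable_const
  rw [ae_iff, ← Set.compl_ofPred, ← lintegral_indicator_one hs.compl,
    lintegral_futureKernel ν t (measurable_one.indicator hs.compl)]
  simp [hist_splice]

lemma futureKernel_comp_self : futureKernel ν t ∘ₘ ν = ν := by
  refine Measure.ext_of_lintegral _ fun F hF => ?_
  have hFs : Measurable fun p : TPath d T × TPath d T => F (splice t p.1 p.2) := by fun_prop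
  rw [Measure.lintegral_bind (Kernel.aemeasurable _) hF.aemeasurable]
  simp_rw [lintegral_futureKernel ν t hF]
  calc ∫⁻ x, ∫⁻ y, F (splice t x y) ∂condDistrib id (hist t) ν (hist t x) ∂ν
      = ∫⁻ x, ∫⁻ y, F (splice t x y) ∂condDistrib id (hist t) ν x ∂(ν.map (hist t)) := by
        rw [lintegral_map (hFs.lintegral_kernel_prod_right) (measurable_hist t)]
        simp_rw [splice_hist_of_le le_rfl]
    _ = ∫⁻ x, F x ∂ν := by
        rw [← Measure.lintegral_compProd hFs, compProd_map_condDistrib aemeasurable_id,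
          lintegral_map hFs (by fun_prop)]
        simp [splice_hist_of_le, splice_self]

lemma lintegral_lintegral_futureKernel {F : TPath d T → ℝ≥0∞} (hF : Measurable F) :
    ∫⁻ x, ∫⁻ y, F y ∂futureKernel ν t x ∂ν = ∫⁻ x, F x ∂ν := by
  rw [← Measure.lintegral_bind (Kernel.aemeasurable _) hF.aemeasurable, futureKernel_comp_self]

lemma lintegral_mul_futureKernel {F G : TPath d T → ℝ≥0∞} (hF : Measurable F)
    (hG : ∀ x, G (hist t x) = G x) (x : TPath d T) :
    ∫⁻ y, G y * F y ∂futureKernel ν t x = G x * ∫⁻ y, F y ∂futureKernel ν t x := by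
  rw [← lintegral_const_mul _ hF]
  refine lintegral_congr_ae ?_
  filter_upwards [ae_futureKernel_hist_eq ν t x] with y hy
  rw [← hG y, hy, hG]

end FutureKernel

section CausalKernel

variable {d T : ℕ}

/-- The law of `y_{1:r}` under `κ x` depends on `x` only through `x_{1:r}`. -/
def IsCausalKernel (κ : Kernel (TPath d T) (TPath d T)) : Prop :=
  ∀ (r : ℕ) (x : TPath d T) (F : TPath d T → ℝ≥0∞), Measurable F → (∀ y, F (hist r y) = F y) →
    ∫⁻ y, F y ∂κ (hist r x) = ∫⁻ y, F y ∂κ x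

lemma isCausalKernel_id : IsCausalKernel (Kernel.id : Kernel (TPath d T) (TPath d T)) := by
  intro r x F hF hFr
  simp [Kernel.id_apply, lintegral_dirac' _ hF, hFr]

lemma IsCausalKernel.comp {κ η : Kernel (TPath d T) (TPath d T)} (hκ : IsCausalKernel κ)
    (hη : IsCausalKernel η) : IsCausalKernel (η ∘ₖ κ) := by
  intro r x F hF hFr
  rw [Kernel.lintegral_comp _ _ _ hF, Kernel.lintegral_comp _ _ _ hF]
  exact hκ r x _ hF.lintegral_kernel fun y => hη r y F hF hFr

/-- The mass that `κ` moves when started from `μ`. -/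
def movedMass (κ : Kernel (TPath d T) (TPath d T)) (μ : Measure (TPath d T)) : ℝ≥0∞ :=
  ∫⁻ x, κ x {x}ᶜ ∂μ

lemma measurable_kernel_compl_singleton (κ : Kernel (TPath d T) (TPath d T)) [IsSFiniteKernel κ] :
    Measurable fun x => κ x {x}ᶜ := by
  have hs : MeasurableSet {p : TPath d T × TPath d T | p.2 ≠ p.1} :=
    (measurableSet_eq_fun measurable_snd measurable_fst).compl
  exact Kernel.measurable_kernel_prodMk_left hs

lemma movedMass_comp_le (κ η : Kernel (TPath d T) (TPath d T)) [IsMarkovKernel κ]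
    [IsMarkovKernel η] (μ : Measure (TPath d T)) :
    movedMass (η ∘ₖ κ) μ ≤ movedMass κ μ + movedMass η (κ ∘ₘ μ) := by
  have hη := measurable_kernel_compl_singleton η
  have hbound (x : TPath d T) :
      (η ∘ₖ κ) x {x}ᶜ ≤ κ x {x}ᶜ + ∫⁻ y, η y {y}ᶜ ∂κ x := by
    rw [Kernel.comp_apply' _ _ _ (measurableSet_singleton x).compl,
      ← lintegral_indicator_one (measurableSet_singleton x).compl, ← lintegral_add_right _ hη]
    refine lintegral_mono fun y => ?_
    by_cases hyx : y = x
    · subst hyx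
      simp
    · calc η y {x}ᶜ ≤ 1 := prob_le_one
        _ ≤ _ := by simp [hyx]
  calc movedMass (η ∘ₖ κ) μ ≤ ∫⁻ x, (κ x {x}ᶜ + ∫⁻ y, η y {y}ᶜ ∂κ x) ∂μ := lintegral_mono hbound
    _ = _ := by
      rw [lintegral_add_right _ hη.lintegral_kernel, movedMass, movedMass,
        Measure.lintegral_bind (Kernel.aemeasurable _) hη.aemeasurable]

end CausalKernel

section Step

variable {d T : ℕ} (ν : Measure (TPath d T)) [IsProbabilityMeasure ν] (t : ℕ)
  (q : TPath d T → ℝ≥0∞)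

/-- The average of `q` given `x_{1:t}` under `ν`. -/
def futureMean (x : TPath d T) : ℝ≥0∞ := ∫⁻ y, q y ∂futureKernel ν t x

/-- The conditional mass that has to be created to turn `q` into its conditional mean. -/
def deficit (x : TPath d T) : ℝ≥0∞ := ∫⁻ y, (futureMean ν t q y - q y) ∂futureKernel ν t x

/-- The conditional density of the normalized deficit. -/
def deficitDensity (x y : TPath d T) : ℝ≥0∞ :=
  if deficit ν t q x = 0 ∨ deficit ν t q x = ∞ then 1
  else (deficit ν t q x)⁻¹ * (futureMean ν t q y - q y)

/-- The probability of not moving the path `x`. -/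
def stayProb (x : TPath d T) : ℝ≥0∞ := min 1 (futureMean ν t q x / q x)

/-- The kernel coupling `q ν` with `futureMean ν t q ν`: it keeps the path with probability
`stayProb` and otherwise resamples it after time `t` from the normalized deficit. -/
def stepKernel : Kernel (TPath d T) (TPath d T) :=
  Kernel.withDensity Kernel.id (fun x _ => stayProb ν t q x)
    + Kernel.withDensity (futureKernel ν t)
      (fun x y => (1 - stayProb ν t q x) * deficitDensity ν t q x y)

variable {q}

lemma measurable_futureMean (hq : Measurable q) : Measurable (futureMean ν t q) :=
  hq.lintegral_kernel

lemma measurable_deficit (hq : Measurable q) : Measurable (deficit ν t q) :=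
  ((measurable_futureMean ν t hq).sub hq).lintegral_kernel

lemma measurable_stayProb (hq : Measurable q) : Measurable (stayProb ν t q) :=
  measurable_const.min ((measurable_futureMean ν t hq).div hq)

lemma measurable_deficitDensity (hq : Measurable q) :
    Measurable (Function.uncurry (deficitDensity ν t q)) := by
  have hp := measurable_futureMean ν t hq
  have he := measurable_deficit ν t hq
  have hs : MeasurableSet {x | deficit ν t q x = 0 ∨ deficit ν t q x = ∞} :=
    (he (measurableSet_singleton 0)).union (he (measurableSet_singleton ∞))
  exact Measurable.ite (measurable_fst hs) measurable_const (by fun_prop)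

variable (q) in
lemma futureMean_hist {r : ℕ} (h : t ≤ r) (x : TPath d T) :
    futureMean ν t q (hist r x) = futureMean ν t q x := by
  simp only [futureMean, futureKernel_hist ν t h]

variable (q) in
lemma deficit_hist {r : ℕ} (h : t ≤ r) (x : TPath d T) :
    deficit ν t q (hist r x) = deficit ν t q x := by
  simp only [deficit, futureKernel_hist ν t h]

variable (q) in
lemma deficitDensity_hist {r : ℕ} (h : t ≤ r) (x y : TPath d T) :
    deficitDensity ν t q (hist r x) y = deficitDensity ν t q x y := by
  simp only [deficitDensity, deficit_hist ν t q h]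

variable (q) in
lemma stayProb_le_one (x : TPath d T) : stayProb ν t q x ≤ 1 := min_le_left _ _

lemma lintegral_stepKernel (hq : Measurable q) {F : TPath d T → ℝ≥0∞} (hF : Measurable F)
    (x : TPath d T) :
    ∫⁻ y, F y ∂stepKernel ν t q x = stayProb ν t q x * F x
      + (1 - stayProb ν t q x) * ∫⁻ y, deficitDensity ν t q x y * F y ∂futureKernel ν t x := by
  have ha := measurable_stayProb ν t hq
  have hdens := measurable_deficitDensity ν t hq
  have hdx : Measurable (deficitDensity ν t q x) := hdens.of_uncurry_left
  rw [stepKernel, add_apply, lintegral_add_measure,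
    Kernel.lintegral_withDensity _ (by fun_prop) _ hF,
    Kernel.lintegral_withDensity _
      ((measurable_const.sub (ha.comp measurable_fst)).mul hdens) _ hF,
    ← lintegral_const_mul _ (by fun_prop), Kernel.id_apply, lintegral_dirac' _ (by fun_prop)]
  simp_rw [mul_assoc]

lemma lintegral_deficitDensity (hq : Measurable q) (x : TPath d T) :
    ∫⁻ y, deficitDensity ν t q x y ∂futureKernel ν t x = 1 := by
  have hp := measurable_futureMean ν t hq
  by_cases h : deficit ν t q x = 0 ∨ deficit ν t q x = ∞
  · simp [deficitDensity, h]
  · simp only [deficitDensity, h, if_false]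
    rw [lintegral_const_mul _ (by fun_prop)]
    push Not at h
    exact ENNReal.inv_mul_cancel h.1 h.2

lemma deficit_mul_lintegral_deficitDensity (hq : Measurable q) {F : TPath d T → ℝ≥0∞}
    (hF : Measurable F) {x : TPath d T} (hx : deficit ν t q x ≠ ∞) :
    deficit ν t q x * ∫⁻ y, deficitDensity ν t q x y * F y ∂futureKernel ν t x
      = ∫⁻ y, (futureMean ν t q y - q y) * F y ∂futureKernel ν t x := by
  have hp := measurable_futureMean ν t hq
  by_cases h : deficit ν t q x = 0
  · rw [h, zero_mul, eq_comm, lintegral_eq_zero_iff (by fun_prop)]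
    filter_upwards [(lintegral_eq_zero_iff (by fun_prop)).1 h] with y hy
    simp_all
  · simp only [deficitDensity, h, hx, or_self, if_false, mul_assoc]
    rw [lintegral_const_mul _ (by fun_prop), ENNReal.mul_inv_cancel_left h hx]

lemma isMarkovKernel_stepKernel (hq : Measurable q) : IsMarkovKernel (stepKernel ν t q) := by
  refine ⟨fun x => ⟨?_⟩⟩
  rw [← lintegral_one, lintegral_stepKernel ν t hq measurable_const]
  simp [lintegral_deficitDensity ν t hq, add_tsub_cancel_of_le (stayProb_le_one ν t q x)]

lemma isCausalKernel_stepKernel (hq : Measurable q) (hqt : ∀ x, q (hist (t + 1) x) = q x) :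
    IsCausalKernel (stepKernel ν t q) := by
  intro r x F hF hFr
  rw [lintegral_stepKernel ν t hq hF, lintegral_stepKernel ν t hq hF]
  rcases le_or_gt r t with hrt | hrt
  · have hFt : ∀ y, F (hist t y) = F y := comp_hist_of_le hrt hFr
    have hone (z : TPath d T) :
        ∫⁻ y, deficitDensity ν t q z y * F y ∂futureKernel ν t z = F z := by
      simp_rw [mul_comm _ (F _)]
      rw [lintegral_mul_futureKernel ν t
          (measurable_deficitDensity ν t hq).of_uncurry_left hFt,
        lintegral_deficitDensity ν t hq, mul_one]
    rw [hone, hone, hFr, ← add_mul, ← add_mul,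
      add_tsub_cancel_of_le (stayProb_le_one ν t q _),
      add_tsub_cancel_of_le (stayProb_le_one ν t q _)]
  · have ha : stayProb ν t q (hist r x) = stayProb ν t q x := by
      simp only [stayProb, futureMean_hist ν t q hrt.le, comp_hist_of_le hrt hqt]
    simp_rw [ha, hFr, deficitDensity_hist ν t q hrt.le, futureKernel_hist ν t hrt.le]

lemma lintegral_futureMean (hq : Measurable q) :
    ∫⁻ x, futureMean ν t q x ∂ν = ∫⁻ x, q x ∂ν :=
  lintegral_lintegral_futureKernel ν t hq

variable (q) in
lemma lintegral_futureKernel_futureMean (x : TPath d T) :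
    ∫⁻ y, futureMean ν t q y ∂futureKernel ν t x = futureMean ν t q x := by
  simpa using lintegral_mul_futureKernel ν t measurable_one (futureMean_hist ν t q le_rfl) x

lemma lintegral_surplus_eq_deficit (hq : Measurable q) {x : TPath d T}
    (hx : futureMean ν t q x ≠ ∞) :
    ∫⁻ y, (q y - futureMean ν t q y) ∂futureKernel ν t x = deficit ν t q x := by
  have hp := measurable_futureMean ν t hq
  refine (ENNReal.add_right_inj hx).1 ?_
  conv_lhs => rw [← lintegral_futureKernel_futureMean]
  rw [← lintegral_add_left hp]
  conv_rhs => rw [futureMean, deficit, ← lintegral_add_left hq]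
  refine lintegral_congr fun y => ?_
  rw [add_tsub_eq_max, add_tsub_eq_max, max_comm]

lemma deficit_ne_top {x : TPath d T} (hx : futureMean ν t q x ≠ ∞) : deficit ν t q x ≠ ∞ := by
  exact ne_top_of_le_ne_top (lintegral_futureKernel_futureMean ν t q x ▸ hx) (lintegral_mono fun y => tsub_le_self)

lemma mul_stayProb {x : TPath d T} (hx : q x ≠ ∞) :
    q x * stayProb ν t q x = min (q x) (futureMean ν t q x) := by
  rcases eq_or_ne (q x) 0 with h0 | h0
  · simp [h0]
  · rw [stayProb, mul_min, mul_one, ENNReal.mul_div_cancel h0 hx]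

lemma mul_one_sub_stayProb {x : TPath d T} (hx : q x ≠ ∞) :
    q x * (1 - stayProb ν t q x) = q x - futureMean ν t q x := by
  rw [ENNReal.mul_sub fun _ _ => hx, mul_one, mul_stayProb ν t hx, tsub_min]

lemma stepKernel_comp_withDensity (hq : Measurable q) (hq1 : ∫⁻ x, q x ∂ν ≠ ∞) :
    stepKernel ν t q ∘ₘ ν.withDensity q = ν.withDensity (futureMean ν t q) := by
  have hp := measurable_futureMean ν t hq
  have ha := measurable_stayProb ν t hq
  have := isMarkovKernel_stepKernel ν t hq
  refine Measure.ext_of_lintegral _ fun F hF => ?_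
  set G : TPath d T → ℝ≥0∞ := fun x =>
    ∫⁻ y, deficitDensity ν t q x y * F y ∂futureKernel ν t x with hG
  have hGm : Measurable G :=
    ((measurable_deficitDensity ν t hq).mul (hF.comp measurable_snd)).lintegral_kernel_prod_right
  have hGt (x) : G (hist t x) = G x := by
    simp only [hG, deficitDensity_hist ν t q le_rfl, futureKernel_hist ν t le_rfl]
  have hpfin : ∀ᵐ x ∂ν, futureMean ν t q x ≠ ∞ :=
    (ae_lt_top hp (by rwa [lintegral_futureMean ν t hq])).mono fun x hx => hx.ne
  have hqfin : ∀ᵐ x ∂ν, q x ≠ ∞ := (ae_lt_top hq hq1).mono fun x hx => hx.ne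
  have hresidual : ∫⁻ x, (q x - futureMean ν t q x) * G x ∂ν
      = ∫⁻ x, (futureMean ν t q x - q x) * F x ∂ν := by
    rw [← lintegral_lintegral_futureKernel ν t (by fun_prop),
      ← lintegral_lintegral_futureKernel ν t (F := fun x => (futureMean ν t q x - q x) * F x)
        (by fun_prop)]
    refine lintegral_congr_ae ?_
    filter_upwards [hpfin] with x hx
    simp_rw [mul_comm _ (G _)]
    rw [lintegral_mul_futureKernel ν t (by fun_prop) hGt,
      lintegral_surplus_eq_deficit ν t hq hx, mul_comm,
      deficit_mul_lintegral_deficitDensity ν t hq hF (deficit_ne_top ν t hx)]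
  rw [Measure.lintegral_bind (Kernel.aemeasurable _) hF.aemeasurable,
    lintegral_withDensity_eq_lintegral_mul _ hq hF.lintegral_kernel,
    lintegral_withDensity_eq_lintegral_mul _ hp hF]
  calc ∫⁻ x, q x * ∫⁻ y, F y ∂stepKernel ν t q x ∂ν
      = ∫⁻ x, (min (q x) (futureMean ν t q x) * F x + (q x - futureMean ν t q x) * G x) ∂ν := by
        refine lintegral_congr_ae ?_
        filter_upwards [hqfin] with x hx
        rw [lintegral_stepKernel ν t hq hF, mul_add, ← mul_assoc, ← mul_assoc,
          mul_stayProb ν t hx, mul_one_sub_stayProb ν t hx]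
    _ = ∫⁻ x, (min (q x) (futureMean ν t q x) * F x + (futureMean ν t q x - q x) * F x) ∂ν := by
        rw [lintegral_add_left (by fun_prop), hresidual, ← lintegral_add_left (by fun_prop)]
    _ = ∫⁻ x, futureMean ν t q x * F x ∂ν := by
        refine lintegral_congr fun x => ?_
        rw [← add_mul, add_comm, min_comm, tsub_add_min]

lemma movedMass_stepKernel_le (hq : Measurable q) (hq1 : ∫⁻ x, q x ∂ν ≠ ∞) :
    movedMass (stepKernel ν t q) (ν.withDensity q) ≤ ∫⁻ x, (q x - futureMean ν t q x) ∂ν := by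
  have := isMarkovKernel_stepKernel ν t hq
  rw [movedMass, lintegral_withDensity_eq_lintegral_mul _ hq
    (measurable_kernel_compl_singleton _)]
  refine lintegral_mono_ae ?_
  filter_upwards [ae_lt_top hq hq1] with x hx
  rw [Pi.mul_apply, ← mul_one_sub_stayProb ν t hx.ne]
  gcongr
  have hs := (measurableSet_singleton x).compl
  rw [← lintegral_indicator_one hs, lintegral_stepKernel ν t hq (measurable_one.indicator hs)]
  have hle : ∫⁻ y, deficitDensity ν t q x y * Set.indicator {x}ᶜ 1 y ∂futureKernel ν t x ≤ 1 := by
    rw [← lintegral_deficitDensity ν t hq x]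
    refine lintegral_mono fun y => mul_le_of_le_one_right' ?_
    exact Set.indicator_le_self' (by simp) y
  simpa using mul_le_of_le_one_right' hle

end Step

section Telescoping

variable {d T : ℕ} (ν : Measure (TPath d T)) [IsProbabilityMeasure ν]

lemma exists_causalKernel (t : ℕ) {q : TPath d T → ℝ≥0∞} (hq : Measurable q)
    (hqt : ∀ x, q (hist t x) = q x) (hq1 : ∫⁻ x, q x ∂ν = 1) :
    ∃ κ : Kernel (TPath d T) (TPath d T), IsMarkovKernel κ ∧ IsCausalKernel κ ∧
      κ ∘ₘ ν.withDensity q = ν ∧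
      movedMass κ (ν.withDensity q) + ∫⁻ x, (1 - q x) ∂ν ≤ 2 * t * ∫⁻ x, (1 - q x) ∂ν := by
  induction t generalizing q with
  | zero =>
    have hq_one : q = 1 := by
      funext x
      have hconst : ∀ y, q y = q 0 := fun y => by rw [← hqt y, hist_zero]
      simp_rw [hconst] at hq1
      simpa [hconst x] using hq1
    refine ⟨Kernel.id, inferInstance, isCausalKernel_id, ?_, ?_⟩
    · simp [hq_one]
    · simp [hq_one, movedMass, Kernel.id_apply]
  | succ t ih =>
    have hp := measurable_futureMean ν t hq
    have hp1 : ∫⁻ x, futureMean ν t q x ∂ν = 1 := by rw [lintegral_futureMean ν t hq, hq1]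
    obtain ⟨κ, hκ, hκc, hκν, hκm⟩ := ih hp (futureMean_hist ν t q le_rfl) hp1
    have := isMarkovKernel_stepKernel ν t hq
    refine ⟨κ ∘ₖ stepKernel ν t q, inferInstance,
      (isCausalKernel_stepKernel ν t hq hqt).comp hκc, ?_, ?_⟩
    · rw [← Measure.comp_assoc, stepKernel_comp_withDensity ν t hq (by simp [hq1]), hκν]
    have hsurplus : ∫⁻ x, (q x - 1) ∂ν = ∫⁻ x, (1 - q x) ∂ν := by
      refine (ENNReal.add_right_inj one_ne_top).1 ?_
      calc 1 + ∫⁻ x, (q x - 1) ∂ν = ∫⁻ x, (1 + (q x - 1)) ∂ν := by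
            rw [lintegral_add_left measurable_const]
            simp
        _ = ∫⁻ x, (q x + (1 - q x)) ∂ν := by
            simp_rw [add_tsub_eq_max, max_comm]
        _ = 1 + ∫⁻ x, (1 - q x) ∂ν := by rw [lintegral_add_left hq, hq1]
    have hcontr : ∫⁻ x, (1 - futureMean ν t q x) ∂ν ≤ ∫⁻ x, (1 - q x) ∂ν := by
      rw [← lintegral_lintegral_futureKernel ν t (by fun_prop : Measurable fun x => 1 - q x)]
      refine lintegral_mono fun x => tsub_le_iff_left.2 ?_
      rw [futureMean, ← lintegral_add_left hq]
      calc (1 : ℝ≥0∞) = ∫⁻ _, 1 ∂futureKernel ν t x := by simp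
        _ ≤ _ := lintegral_mono fun y => le_add_tsub
    have hstep : movedMass (stepKernel ν t q) (ν.withDensity q)
        ≤ ∫⁻ x, (1 - q x) ∂ν + ∫⁻ x, (1 - futureMean ν t q x) ∂ν := by
      refine (movedMass_stepKernel_le ν t hq (by simp [hq1])).trans ?_
      rw [← hsurplus, ← lintegral_add_left (by fun_prop)]
      exact lintegral_mono fun x => tsub_le_tsub_add_tsub
    have hcomp := movedMass_comp_le (stepKernel ν t q) κ (ν.withDensity q)
    rw [stepKernel_comp_withDensity ν t hq (by simp [hq1])] at hcomp
    set δ := ∫⁻ x, (1 - q x) ∂ν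
    set δ' := ∫⁻ x, (1 - futureMean ν t q x) ∂ν
    calc movedMass (κ ∘ₖ stepKernel ν t q) (ν.withDensity q) + δ
        ≤ (δ + δ' + movedMass κ (ν.withDensity (futureMean ν t q))) + δ := by
          gcongr
          exact hcomp.trans (by gcongr)
      _ = 2 * δ + (movedMass κ (ν.withDensity (futureMean ν t q)) + δ') := by ring
      _ ≤ 2 * δ + 2 * t * δ' := by gcongr
      _ ≤ 2 * δ + 2 * t * δ := by gcongr
      _ = 2 * ↑(t + 1) * δ := by push_cast; ring

end Telescoping

section Pinsker

variable {E : Type*} [MeasurableSpace E] {μ ν : Measure E}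

/-- Fenchel–Young inequality for `x ↦ x log x - x + 1`. -/
lemma mul_sub_exp_add_one_le_klFun {x : ℝ} (hx : 0 ≤ x) (s : ℝ) :
    x * s - Real.exp s + 1 ≤ InformationTheory.klFun x := by
  rw [InformationTheory.klFun]
  rcases hx.eq_or_lt with rfl | hx
  · have := Real.exp_pos s
    simp [this.le]
  · have hlog := Real.log_le_sub_one_of_pos (div_pos (Real.exp_pos s) hx)
    rw [Real.log_div (Real.exp_pos s).ne' hx.ne', Real.log_exp] at hlog
    have := mul_le_mul_of_nonneg_left hlog hx.le
    have hcancel : x * (Real.exp s / x - 1) = Real.exp s - x := by field_simp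
    nlinarith

/-- **Pinsker's inequality** for a single event. -/
lemma measureReal_sub_le_sqrt_integral_llr [IsProbabilityMeasure μ] [IsProbabilityMeasure ν]
    (hμν : μ ≪ ν) (h_int : Integrable (llr μ ν) μ) {B : Set E} (hB : MeasurableSet B) :
    ν.real B - μ.real B ≤ Real.sqrt ((∫ x, llr μ ν x ∂μ) / 2) := by
  set Δ := ν.real B - μ.real B with hΔ
  set X : E → ℝ := B.indicator 1 with hX
  have hXm : Measurable X := measurable_one.indicator hB
  have hX01 (x) : X x ∈ Set.Icc (0 : ℝ) 1 := by
    by_cases hx : x ∈ B <;> simp [hX, hx]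
  have hXν : ∫ x, X x ∂ν = ν.real B := integral_indicator_one hB
  have hXμ : ∫ x, X x ∂μ = μ.real B := integral_indicator_one hB
  have hXint : Integrable X μ := (integrable_const (1 : ℝ)).indicator hB
  have hsub := hasSubgaussianMGF_of_mem_Icc (μ := ν) hXm.aemeasurable (ae_of_all _ hX01)
  have hmgf := hsub.mgf_le (-4 * Δ)
  set s : E → ℝ := fun x => -4 * Δ * (X x - ν.real B) - 2 * Δ ^ 2 with hs
  have hsm : Measurable s := by fun_prop
  have hexp (x) : Real.exp (s x)
      = Real.exp (-4 * Δ * (X x - ∫ y, X y ∂ν)) * Real.exp (-(2 * Δ ^ 2)) := by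
    rw [← Real.exp_add, hs, hXν]
    ring_nf
  have hexp_int : Integrable (fun x => Real.exp (s x)) ν := by
    simp_rw [hexp]
    exact (hsub.integrable_exp_mul _).mul_const _
  have hexp_le : ∫ x, Real.exp (s x) ∂ν ≤ 1 := by
    simp_rw [hexp]
    rw [integral_mul_const]
    calc _ ≤ Real.exp (2 * Δ ^ 2) * Real.exp (-(2 * Δ ^ 2)) := by
          gcongr
          refine hmgf.trans_eq ?_
          congr 1
          push_cast
          norm_num
          ring
      _ = 1 := by rw [← Real.exp_add]; simp
  have hs_int : Integrable s μ := ((hXint.sub (integrable_const _)).const_mul _).sub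
    (integrable_const _)
  have hs_eq : ∫ x, s x ∂μ = 2 * Δ ^ 2 := by
    rw [hs, integral_sub (by fun_prop) (integrable_const _), integral_const_mul,
      integral_sub hXint (integrable_const _), hXμ]
    simp
    rw [hΔ]
    ring
  have hGs_int : Integrable (fun x => (μ.rnDeriv ν x).toReal * s x) ν :=
    (integrable_rnDeriv_smul_iff hμν).2 hs_int
  have hGs : ∫ x, (μ.rnDeriv ν x).toReal * s x ∂ν = ∫ x, s x ∂μ := integral_rnDeriv_smul hμν
  have hkl := InformationTheory.integral_klFun_rnDeriv hμν h_int
  have hdiff_int : Integrable (fun x => (μ.rnDeriv ν x).toReal * s x - Real.exp (s x)) ν :=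
    hGs_int.sub hexp_int
  have hle : ∫ x, ((μ.rnDeriv ν x).toReal * s x - Real.exp (s x) + 1) ∂ν
      ≤ ∫ x, InformationTheory.klFun (μ.rnDeriv ν x).toReal ∂ν :=
    integral_mono (hdiff_int.add (integrable_const _))
      ((InformationTheory.integrable_klFun_rnDeriv_iff hμν).2 h_int)
      fun x => mul_sub_exp_add_one_le_klFun ENNReal.toReal_nonneg _
  rw [integral_add hdiff_int (integrable_const _), integral_sub hGs_int hexp_int, hGs,
    hs_eq, hkl] at hle
  simp at hle
  refine Real.le_sqrt_of_sq_le ?_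
  linarith

/-- The total variation of `μ ≪ ν` is attained at the event where the density is less than one. -/
lemma exists_lintegral_one_sub_rnDeriv_eq [IsFiniteMeasure μ] [IsFiniteMeasure ν] (hμν : μ ≪ ν) :
    ∃ A, MeasurableSet A ∧
      ∫⁻ x, (1 - μ.rnDeriv ν x) ∂ν = ENNReal.ofReal (ν.real A - μ.real A) := by
  have hq := Measure.measurable_rnDeriv μ ν
  have hA : MeasurableSet {x | μ.rnDeriv ν x < 1} := measurableSet_lt hq measurable_const
  refine ⟨_, hA, ?_⟩
  set A := {x | μ.rnDeriv ν x < 1} with hAdef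
  have hμA : ∫⁻ x in A, μ.rnDeriv ν x ∂ν = μ A := Measure.setLIntegral_rnDeriv hμν A
  have hind : (fun x => 1 - μ.rnDeriv ν x) = A.indicator fun x => 1 - μ.rnDeriv ν x := by
    funext x
    by_cases hx : x ∈ A
    · simp [hx]
    · rw [Set.indicator_of_notMem hx]
      exact tsub_eq_zero_of_le (not_lt.1 hx)
  rw [hind, lintegral_indicator hA, lintegral_sub hq (by simp [hμA])
    ((ae_restrict_mem hA).mono fun x hx => le_of_lt hx), hμA, setLIntegral_one,
    ENNReal.ofReal_sub _ measureReal_nonneg, ofReal_measureReal, ofReal_measureReal]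

end Pinsker

section PathNorm

variable {d T : ℕ}

lemma eNorm_nonneg (v : Fin d → ℝ) : 0 ≤ eNorm v := Real.sqrt_nonneg _

end PathNorm

section Coupling

variable {d T : ℕ}

lemma IsCausalKernel.integral_hist {κ : Kernel (TPath d T) (TPath d T)} (hκ : IsCausalKernel κ)
    (r : ℕ) {f : TPath d T → ℝ} (hf : Measurable f) (hfr : ∀ y, f (hist r y) = f y)
    (x : TPath d T) : ∫ y, f y ∂κ (hist r x) = ∫ y, f y ∂κ x := by
  have hr := measurable_hist (d := d) (T := T) r
  have hmap : (κ (hist r x)).map (hist r) = (κ x).map (hist r) := by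
    refine Measure.ext_of_lintegral _ fun F hF => ?_
    rw [lintegral_map hF hr, lintegral_map hF hr]
    exact hκ r x _ (hF.comp hr) fun y => by rw [hist_hist, min_self]
  have key (x : TPath d T) : ∫ y, f y ∂κ x = ∫ y, f y ∂(κ x).map (hist r) := by
    rw [integral_map hr.aemeasurable hf.aestronglyMeasurable]
    simp_rw [hfr]
  rw [key, hmap, ← key]

lemma IsCausalKernel.isCausalCoupling_compProd {κ : Kernel (TPath d T) (TPath d T)}
    [IsMarkovKernel κ] (hκ : IsCausalKernel κ) (μ : Measure (TPath d T)) [IsProbabilityMeasure μ] :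
    IsCausalCoupling (μ ⊗ₘ κ) := by
  rintro t - f hf hft ⟨C, hC⟩
  set π := μ ⊗ₘ κ with hπ
  set φ : TPath d T → ℝ := fun x => ∫ y, f y ∂κ x with hφ
  have hφm : Measurable φ := hf.stronglyMeasurable.integral_kernel.measurable
  have hint : Integrable (fun p : TPath d T × TPath d T => f p.2) π :=
    Integrable.of_bound (hf.comp measurable_snd).aestronglyMeasurable C (ae_of_all _ fun p => hC _)
  have hle : MeasurableSpace.comap (fun p : TPath d T × TPath d T => hist t p.1) inferInstance
      ≤ MeasurableSpace.comap Prod.fst inferInstance := by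
    rw [show (fun p : TPath d T × TPath d T => hist t p.1) = hist t ∘ Prod.fst from rfl,
      ← MeasurableSpace.comap_comp]
    exact MeasurableSpace.comap_mono (measurable_hist t).comap_le
  have hcond : condDistrib Prod.snd Prod.fst π =ᵐ[π.map Prod.fst] κ := by
    refine condDistrib_ae_eq_of_measure_eq_compProd _ measurable_snd.aemeasurable ?_
    have hfst : π.map Prod.fst = μ := Measure.fst_compProd μ κ
    rw [hfst]
    exact Measure.map_id
  have hfst : π[(fun p => f p.2) | MeasurableSpace.comap Prod.fst inferInstance]
      =ᵐ[π] fun p => φ (hist t p.1) := by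
    refine (condExp_ae_eq_integral_condDistrib measurable_fst measurable_snd.aemeasurable
      hf.stronglyMeasurable hint).trans ?_
    filter_upwards [ae_of_ae_map measurable_fst.aemeasurable hcond] with p hp
    rw [hp, hφ]
    exact (hκ.integral_hist t hf hft p.1).symm
  have hsm : StronglyMeasurable[MeasurableSpace.comap
      (fun p : TPath d T × TPath d T => hist t p.1) inferInstance]
      fun p : TPath d T × TPath d T => φ (hist t p.1) :=
    (hφm.comp (comap_measurable _)).stronglyMeasurable
  have hφint : Integrable (fun p : TPath d T × TPath d T => φ (hist t p.1)) π :=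
    integrable_condExp.congr hfst
  refine hfst.trans ?_
  rw [← condExp_of_stronglyMeasurable (hle.trans measurable_fst.comap_le) hsm hφint]
  exact (condExp_congr_ae hfst.symm).trans (condExp_condExp_of_le hle measurable_fst.comap_le)

lemma CW1_le_of_isCausalKernel {μ ν : Measure (TPath d T)} [IsProbabilityMeasure μ]
    (hμ : ∀ᵐ x ∂μ, pathNorm x ≤ 1) (hν : ∀ᵐ x ∂ν, pathNorm x ≤ 1)
    {κ : Kernel (TPath d T) (TPath d T)} [IsMarkovKernel κ] (hκ : IsCausalKernel κ)
    (hκν : κ ∘ₘ μ = ν) : CW1 μ ν ≤ 2 * (movedMass κ μ).toReal := by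
  set π := μ ⊗ₘ κ with hπ
  have hfst : π.map Prod.fst = μ := Measure.fst_compProd μ κ
  have hsnd : π.map Prod.snd = ν := (Measure.snd_compProd μ κ).trans hκν
  have hD : MeasurableSet {p : TPath d T × TPath d T | p.2 ≠ p.1} :=
    (measurableSet_eq_fun measurable_snd measurable_fst).compl
  have hmass : π {p | p.2 ≠ p.1} = movedMass κ μ := Measure.compProd_apply hD
  have hcost : ∫ p, pathNorm (p.1 - p.2) ∂π ≤ 2 * (movedMass κ μ).toReal := by
    rw [← hmass, ← measureReal_def, ← integral_indicator_one hD, ← integral_const_mul]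
    refine integral_mono_of_nonneg (ae_of_all _ fun p => pathNorm_nonneg _)
      (((integrable_const (1 : ℝ)).indicator hD).const_mul 2) ?_
    filter_upwards [ae_of_ae_map measurable_fst.aemeasurable (hfst.symm ▸ hμ),
      ae_of_ae_map measurable_snd.aemeasurable (hsnd.symm ▸ hν)] with p hp₁ hp₂
    by_cases hp : p.2 = p.1
    · simp [hp, pathNorm_zero]
    · have := pathNorm_sub_le p.1 p.2
      rw [Set.indicator_of_mem (by exact hp)]
      simp only [Pi.one_apply]
      linarith
  rw [CW1]
  refine le_trans (csInf_le ⟨0, ?_⟩ ⟨π, ⟨hfst, hsnd⟩, hκ.isCausalCoupling_compProd μ, rfl⟩) hcost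
  rintro _ ⟨_, _, _, rfl⟩
  exact integral_nonneg fun p => pathNorm_nonneg _

/-- The causal Wasserstein distance of laws on the unit ball is controlled by their
total variation. -/
lemma CW1_le_lintegral_one_sub_rnDeriv {μ ν : Measure (TPath d T)} [IsProbabilityMeasure μ]
    [IsProbabilityMeasure ν] (hμν : μ ≪ ν) (hμ : ∀ᵐ x ∂μ, pathNorm x ≤ 1)
    (hν : ∀ᵐ x ∂ν, pathNorm x ≤ 1) :
    CW1 μ ν ≤ 2 * (2 ^ T - 1) * (∫⁻ x, (1 - μ.rnDeriv ν x) ∂ν).toReal := by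
  have hμq : ν.withDensity (μ.rnDeriv ν) = μ := Measure.withDensity_rnDeriv_eq μ ν hμν
  obtain ⟨κ, _, hκ, hκν, hmass⟩ := exists_causalKernel ν T (Measure.measurable_rnDeriv μ ν)
    (fun x => by rw [hist_of_le le_rfl])
    (by rw [Measure.lintegral_rnDeriv hμν, measure_univ])
  rw [hμq] at hκν hmass
  have hδ : ∫⁻ x, (1 - μ.rnDeriv ν x) ∂ν ≠ ∞ := by
    refine ne_top_of_le_ne_top one_ne_top ?_
    calc ∫⁻ x, (1 - μ.rnDeriv ν x) ∂ν ≤ ∫⁻ _, 1 ∂ν := lintegral_mono fun _ => tsub_le_self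
      _ = 1 := by simp
  set δ := ∫⁻ x, (1 - μ.rnDeriv ν x) ∂ν
  have hrhs : 2 * (T : ℝ≥0∞) * δ ≠ ∞ := by finiteness
  have hm : movedMass κ μ ≠ ∞ := ne_top_of_le_ne_top hrhs (le_self_add.trans hmass)
  have hreal := ENNReal.toReal_mono hrhs hmass
  rw [ENNReal.toReal_add hm hδ] at hreal
  simp only [toReal_mul, toReal_ofNat, toReal_natCast] at hreal
  have hpow : (2 * T : ℝ) ≤ 2 ^ T := by
    have : 2 * T ≤ 2 ^ T := by
      cases T with
      | zero => simp
      | succ n => rw [pow_succ, mul_comm]; gcongr; exact n.lt_two_pow_self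
    exact_mod_cast this
  have hfin := CW1_le_of_isCausalKernel hμ hν hκ hκν
  have := mul_le_mul_of_nonneg_right hpow (ENNReal.toReal_nonneg (a := δ))
  linarith

end Coupling

/-- `CW₁(μ_rec, μ_gen) ≤ C·√(D_KL(μ_latent | μ_prior)/2)` with `C = 2(2^T − 1)`, when both
push-forwards are supported in the unit ball. -/
theorem stmt6 (d dZ T : ℕ) (De : TPath dZ T → TPath d T) (hDe : Measurable De)
    (μlatent μprior : Measure (TPath dZ T))
    [IsProbabilityMeasure μlatent] [IsProbabilityMeasure μprior]
    (hrec : ∀ᵐ x ∂(μlatent.map De), pathNorm x ≤ 1)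
    (hgen : ∀ᵐ x ∂(μprior.map De), pathNorm x ≤ 1) :
    ENNReal.ofReal (CW1 (μlatent.map De) (μprior.map De))
      ≤ ENNReal.ofReal (2 * (2 ^ T - 1)) * (2⁻¹ * KLDiv μlatent μprior) ^ (2⁻¹ : ℝ) := by
  by_cases hKL : μlatent ≪ μprior ∧ Integrable (llr μlatent μprior) μlatent
  · have := Measure.isProbabilityMeasure_map (μ := μlatent) hDe.aemeasurable
    have := Measure.isProbabilityMeasure_map (μ := μprior) hDe.aemeasurable
    have hac := hKL.1.map hDe
    obtain ⟨A, hA, hδ⟩ := exists_lintegral_one_sub_rnDeriv_eq hac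
    have hpinsker := measureReal_sub_le_sqrt_integral_llr hKL.1 hKL.2 (hDe hA)
    rw [← map_measureReal_apply hDe hA, ← map_measureReal_apply hDe hA] at hpinsker
    have hC : (0 : ℝ) ≤ 2 * (2 ^ T - 1) :=
      mul_nonneg zero_le_two (sub_nonneg.2 (one_le_pow₀ one_le_two))
    have hCW := CW1_le_lintegral_one_sub_rnDeriv hac hrec hgen
    rw [hδ] at hCW
    have hllr : 0 ≤ (∫ x, llr μlatent μprior x ∂μlatent) / 2 := by
      have := InformationTheory.integral_llr_add_sub_measure_univ_nonneg hKL.1 hKL.2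
      simp at this
      linarith
    have hsqrt : (2⁻¹ * KLDiv μlatent μprior) ^ (2⁻¹ : ℝ)
        = ENNReal.ofReal (Real.sqrt ((∫ x, llr μlatent μprior x ∂μlatent) / 2)) := by
      rw [KLDiv, if_pos hKL, Real.sqrt_eq_rpow, one_div,
        ← ENNReal.ofReal_rpow_of_nonneg hllr (by norm_num), div_eq_inv_mul,
        ENNReal.ofReal_mul (by norm_num), ENNReal.ofReal_inv_of_pos two_pos, ENNReal.ofReal_ofNat]
    rw [hsqrt, ← ENNReal.ofReal_mul hC]
    refine ENNReal.ofReal_le_ofReal (hCW.trans (mul_le_mul_of_nonneg_left ?_ hC))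
    exact ENNReal.toReal_le_of_le_ofReal (Real.sqrt_nonneg _) (ENNReal.ofReal_le_ofReal hpinsker)
  · rcases Nat.eq_zero_or_pos T with rfl | hT
    · have hCW : CW1 (μlatent.map De) (μprior.map De) ≤ 0 := by
        refine Real.sInf_nonpos ?_
        rintro _ ⟨π, -, -, rfl⟩
        simp [pathNorm]
      rw [ENNReal.ofReal_of_nonpos hCW]
      exact zero_le
    · have hC : (0 : ℝ) < 2 * (2 ^ T - 1) :=
        _root_.mul_pos two_pos (sub_pos.2 (one_lt_pow₀ _root_.one_lt_two hT.ne'))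
      rw [KLDiv, if_neg hKL, ENNReal.mul_top (by simp), ENNReal.top_rpow_of_pos (by norm_num),
        ENNReal.mul_top (by simpa using hC)]
      exact le_top

end
end
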